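/- arXiv:1704.02660 — 4 statements merged into one kernel-verified Lean document; each statement's English description precedes it below -/
import Mathlib

section
/- Let c ∈ ℝ and n ≥ 1. Let (T, ℰ, Q) be a probability space and for each t ∈ T let ν_t be a Borel probability measure on ℝ that is n-completely mixable with n-center c, such that t ↦ ν_t(B) is ℰ-measurable for every Borel set B ⊂ ℝ. Then the mixture ν defined by ν(B) = ∫_T ν_t(B) Q(dt) is n-completely mixable with n-center c. -/
open MeasureTheory ENNReal

/-- The tuple `μ` of Borel probability measures on ℝ is jointly mixable with center `C`:
there is a probability measure on ℝⁿ whose `i`-th one-dimensional marginal is `μ i` for each `i`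
and which gives probability one to the hyperplane `{x : x₁ + ⋯ + xₙ = C}`. -/
def IsJointMix (n : ℕ) (μ : Fin n → Measure ℝ) (C : ℝ) : Prop :=
  ∃ P : Measure (Fin n → ℝ), IsProbabilityMeasure P ∧
    (∀ i, P.map (fun x => x i) = μ i) ∧
    P {x | ∑ i, x i = C} = 1

/-- A Borel probability measure `μ` on ℝ is `n`-completely mixable with `n`-center `c`. -/
def IsCompletelyMixable (n : ℕ) (μ : Measure ℝ) (c : ℝ) : Prop :=
  IsJointMix n (fun _ => μ) (n * c)

open Filter Topology ProbabilityTheory BoundedContinuousFunction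

lemma isTightMeasureSet_pi_of_map_eval {ι : Type*} [Fintype ι] {X : ι → Type*}
    [∀ i, TopologicalSpace (X i)] [∀ i, T2Space (X i)] [∀ i, MeasurableSpace (X i)]
    [∀ i, OpensMeasurableSpace (X i)] {S : Set (Measure (∀ i, X i))}
    (hS : ∀ i, IsTightMeasureSet ((fun P => P.map (fun x => x i)) '' S)) :
    IsTightMeasureSet S := by
  simp only [isTightMeasureSet_iff_exists_isCompact_measure_compl_le, Set.forall_mem_image] at hS ⊢
  intro ε hε
  have hε' : 0 < ε / (Fintype.card ι : ℝ≥0∞) := ENNReal.div_pos hε.ne' (by simp)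
  choose K hK hKS using fun i => hS i _ hε'
  refine ⟨Set.univ.pi K, isCompact_univ_pi hK, fun P hP => ?_⟩
  calc P (Set.univ.pi K)ᶜ
      ≤ P (⋃ i, (fun x => x i) ⁻¹' (K i)ᶜ) := by
        refine measure_mono fun x hx => ?_
        simpa [Set.mem_pi] using hx
    _ ≤ ∑ i, P ((fun x => x i) ⁻¹' (K i)ᶜ) := measure_iUnion_fintype_le _ _
    _ ≤ ∑ _i : ι, ε / (Fintype.card ι : ℝ≥0∞) := by
        refine Finset.sum_le_sum fun i _ => ?_
        have h := hKS i hP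
        rwa [Measure.map_apply (measurable_pi_apply i) (hK i).measurableSet.compl] at h
    _ ≤ ε := by
        rw [Finset.sum_const, Finset.card_univ, nsmul_eq_mul]
        exact ENNReal.mul_div_le

lemma IsCompletelyMixable.convexCombination {n : ℕ} {c : ℝ} {μ₁ μ₂ : Measure ℝ}
    (h₁ : IsCompletelyMixable n μ₁ c) (h₂ : IsCompletelyMixable n μ₂ c)
    {a b : ℝ≥0∞} (hab : a + b = 1) : IsCompletelyMixable n (a • μ₁ + b • μ₂) c := by
  obtain ⟨P₁, hP₁, hm₁, hs₁⟩ := h₁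
  obtain ⟨P₂, hP₂, hm₂, hs₂⟩ := h₂
  refine ⟨a • P₁ + b • P₂, ⟨by simp [hab]⟩, fun i => ?_, by simp [hs₁, hs₂, hab]⟩
  rw [Measure.map_add _ _ (measurable_pi_apply i), Measure.map_smul, Measure.map_smul, hm₁, hm₂]

lemma IsCompletelyMixable.of_tendsto {n : ℕ} {c : ℝ} {ρ : ℕ → ProbabilityMeasure ℝ}
    {ν : ProbabilityMeasure ℝ} (hρ : ∀ k, IsCompletelyMixable n (ρ k) c)
    (hlim : Tendsto ρ atTop (𝓝 ν)) : IsCompletelyMixable n ν c := by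
  choose P hP hmarg hsum using hρ
  let R : ℕ → ProbabilityMeasure (Fin n → ℝ) := fun k => ⟨P k, hP k⟩
  have htight : IsTightMeasureSet {x | ∃ μ ∈ Set.range ρ, (μ : Measure ℝ) = x} :=
    isTightMeasureSet_of_isCompact_closure <|
      hlim.isCompact_insert_range.closure_of_subset (Set.subset_insert _ _)
  have hRtight : IsTightMeasureSet {x | ∃ μ ∈ Set.range R, (μ : Measure (Fin n → ℝ)) = x} := by
    refine isTightMeasureSet_pi_of_map_eval fun i => htight.subset ?_
    rintro _ ⟨_, ⟨_, ⟨k, rfl⟩, rfl⟩, rfl⟩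
    exact ⟨ρ k, ⟨k, rfl⟩, (hmarg k i).symm⟩
  obtain ⟨L, -, φ, hφ, hL⟩ := (isCompact_closure_of_isTightMeasureSet hRtight).tendsto_subseq
    (x := R) fun k => subset_closure ⟨k, rfl⟩
  refine ⟨L, inferInstance, fun i => ?_, le_antisymm prob_le_one ?_⟩
  · have h₁ := ProbabilityMeasure.tendsto_map_of_tendsto_of_continuous _ _ hL (continuous_apply i)
    have h₂ : Tendsto (fun k => ((R ∘ φ) k).map
        (continuous_apply i).measurable.aemeasurable) atTop (𝓝 ν) := by
      refine (hlim.comp hφ.tendsto_atTop).congr fun k => Subtype.ext ?_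
      exact (hmarg (φ k) i).symm
    exact congrArg (fun μ : ProbabilityMeasure ℝ => (μ : Measure ℝ)) (tendsto_nhds_unique h₁ h₂)
  · have hcl : IsClosed {x : Fin n → ℝ | ∑ i, x i = n * c} :=
      isClosed_eq (by fun_prop) continuous_const
    have h := ProbabilityMeasure.limsup_measure_closed_le_of_tendsto hL hcl
    have hone (k : ℕ) : ((R ∘ φ) k : Measure (Fin n → ℝ)) {x | ∑ i, x i = n * c} = 1 := hsum (φ k)
    simp_rw [hone] at h
    rwa [limsup_const] at h

lemma convex_integrals_isCompletelyMixable (n : ℕ) (c : ℝ) (F : Finset (ℝ →ᵇ ℝ)) :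
    Convex ℝ ((fun (ρ : ProbabilityMeasure ℝ) (f : F) => ∫ x, f.1 x ∂(ρ : Measure ℝ)) ''
      {ρ | IsCompletelyMixable n ρ c}) := by
  rintro _ ⟨ρ₁, h₁, rfl⟩ _ ⟨ρ₂, h₂, rfl⟩ a b ha hb hab
  have hab' : ENNReal.ofReal a + ENNReal.ofReal b = 1 := by
    rw [← ENNReal.ofReal_add ha hb, hab, ENNReal.ofReal_one]
  refine ⟨⟨ENNReal.ofReal a • (ρ₁ : Measure ℝ) + ENNReal.ofReal b • (ρ₂ : Measure ℝ),
    ⟨by simp [hab']⟩⟩, IsCompletelyMixable.convexCombination h₁ h₂ hab', ?_⟩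
  ext f
  have i₁ := (f.1.integrable (ρ₁ : Measure ℝ)).smul_measure (ENNReal.ofReal_ne_top (r := a))
  have i₂ := (f.1.integrable (ρ₂ : Measure ℝ)).smul_measure (ENNReal.ofReal_ne_top (r := b))
  simp [integral_add_measure i₁ i₂, ha, hb]

lemma exists_isCompletelyMixable_integral_near {T : Type*} [MeasurableSpace T] {n : ℕ} {c : ℝ}
    {Q : Measure T} [IsProbabilityMeasure Q] (κ : Kernel T ℝ) [IsMarkovKernel κ]
    (hκ : ∀ t, IsCompletelyMixable n (κ t) c) (F : Finset (ℝ →ᵇ ℝ)) {ε : ℝ} (hε : 0 < ε) :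
    ∃ ρ : ProbabilityMeasure ℝ, IsCompletelyMixable n ρ c ∧
      ∀ f ∈ F, dist (∫ x, f x ∂(ρ : Measure ℝ)) (∫ x, f x ∂(Q.bind κ)) < ε := by
  have hint (f : ℝ →ᵇ ℝ) : Integrable (fun t => ∫ x, f x ∂(κ t)) Q := by
    have h : Integrable f ((κ ∘ₖ Kernel.const Unit Q) ()) := f.integrable _
    exact h.integral_comp
  have hbind (f : ℝ →ᵇ ℝ) : ∫ x, f x ∂(Q.bind κ) = ∫ t, ∫ x, f x ∂(κ t) ∂Q := by
    have h : Integrable f ((κ ∘ₖ Kernel.const Unit Q) ()) := f.integrable _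
    simpa [Kernel.comp_apply] using Kernel.integral_comp h
  have hmem := (convex_integrals_isCompletelyMixable n c F).closure.integral_mem (μ := Q)
    (f := fun t (f : F) => ∫ x, f.1 x ∂(κ t)) isClosed_closure
    (ae_of_all _ fun t => subset_closure ⟨⟨κ t, inferInstance⟩, hκ t, rfl⟩)
    (Integrable.of_eval fun f => hint f.1)
  obtain ⟨_, ⟨ρ, hρ, rfl⟩, hdist⟩ := Metric.mem_closure_iff.1 hmem ε hε
  refine ⟨ρ, hρ, fun f hf => ?_⟩
  have h := (dist_le_pi_dist _ _ (⟨f, hf⟩ : F)).trans_lt hdist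
  have heval := eval_integral (f := fun t (f : F) => ∫ x, f.1 x ∂(κ t)) (fun f => hint f.1) ⟨f, hf⟩
  rwa [heval, dist_comm, ← hbind] at h

lemma isCompletelyMixable_bind {T : Type*} [MeasurableSpace T] {n : ℕ} {c : ℝ}
    {Q : Measure T} [IsProbabilityMeasure Q] (κ : Kernel T ℝ) [IsMarkovKernel κ]
    (hκ : ∀ t, IsCompletelyMixable n (κ t) c) : IsCompletelyMixable n (Q.bind κ) c := by
  classical
  let ν : ProbabilityMeasure ℝ := ⟨Q.bind κ, inferInstance⟩
  choose ρ hρ hnear using fun p : Finset (ℝ →ᵇ ℝ) × ℕ =>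
    exists_isCompletelyMixable_integral_near (Q := Q) κ hκ p.1
      (Nat.one_div_pos_of_nat (α := ℝ) (n := p.2))
  have hlim : Tendsto ρ atTop (𝓝 ν) := by
    refine ProbabilityMeasure.tendsto_iff_forall_integral_tendsto.2 fun f =>
      Metric.tendsto_nhds.2 fun ε hε => ?_
    obtain ⟨N, hN⟩ := exists_nat_one_div_lt (K := ℝ) hε
    filter_upwards [eventually_ge_atTop (({f}, N) : Finset (ℝ →ᵇ ℝ) × ℕ)] with p hp
    have hf : f ∈ p.1 := hp.1 (Finset.mem_singleton_self f)
    exact (hnear p f hf).trans ((Nat.one_div_le_one_div hp.2).trans_lt hN)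
  have hcl : ν ∈ closure {ρ : ProbabilityMeasure ℝ | IsCompletelyMixable n ρ c} :=
    mem_closure_of_tendsto hlim (Eventually.of_forall hρ)
  obtain ⟨σ, hσ, hσlim⟩ := mem_closure_iff_seq_limit.1 hcl
  exact IsCompletelyMixable.of_tendsto hσ hσlim


theorem stmt13 (n : ℕ) (c : ℝ) (T : Type*) [MeasurableSpace T]
    (Q : Measure T) [IsProbabilityMeasure Q]
    (νt : T → Measure ℝ) (hprob : ∀ t, IsProbabilityMeasure (νt t))
    (hCM : ∀ t, IsCompletelyMixable n (νt t) c)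
    (hmeas : ∀ B : Set ℝ, MeasurableSet B → Measurable (fun t => νt t B))
    (ν : Measure ℝ)
    (hν : ∀ B : Set ℝ, MeasurableSet B → ν B = ∫⁻ t, νt t B ∂Q) :
    IsCompletelyMixable n ν c := by
  let κ : Kernel T ℝ := ⟨νt, Measure.measurable_of_measurable_coe νt hmeas⟩
  have : IsMarkovKernel κ := ⟨hprob⟩
  have hνκ : ν = Q.bind κ := Measure.ext fun B hB => by
    rw [hν B hB, Measure.bind_apply hB κ.aemeasurable]
    rfl
  rw [hνκ]
  exact isCompletelyMixable_bind κ hCM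
end

section
/- For every n ≥ 2, the set of n-centers of the standard Cauchy distribution is exactly the interval [−log(n−1)/π, log(n−1)/π]. Equivalently, there exists a probability measure λ on ℝⁿ whose one-dimensional marginals all equal the standard Cauchy distribution and which gives probability one to the hyperplane {x : x₁+⋯+xₙ = C} if and only if |C| ≤ n·log(n−1)/π. -/
open MeasureTheory ENNReal

/-- The standard Cauchy distribution on ℝ. -/
noncomputable def stdCauchy : Measure ℝ :=
  volume.withDensity (fun x => ENNReal.ofReal ((Real.pi * (1 + x ^ 2))⁻¹))


section

open Filter Topology Complex FourierTransform

lemma exists_probabilityMeasure_charFun_eq_pow (μ : Measure ℝ) [IsProbabilityMeasure μ] (k : ℕ) :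
    ∃ ν : Measure ℝ, IsProbabilityMeasure ν ∧ ∀ t, charFun ν t = charFun μ t ^ k := by
  induction k with
  | zero => exact ⟨Measure.dirac 0, inferInstance, fun t => by simp⟩
  | succ k ih =>
    obtain ⟨ν, hν, h⟩ := ih
    exact ⟨ν.conv μ, inferInstance, fun t => by rw [charFun_conv, h, pow_succ]⟩

lemma exists_probabilityMeasure_of_tendsto_charFun {μ : ℕ → Measure ℝ}
    [∀ i, IsProbabilityMeasure (μ i)] {f : ℝ → ℂ} (hf : ContinuousAt f 0)
    (h : ∀ t, Tendsto (fun n => charFun (μ n) t) atTop (𝓝 (f t))) :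
    ∃ ν : Measure ℝ, IsProbabilityMeasure ν ∧ ∀ t, charFun ν t = f t := by
  have h_tight := isTightMeasureSet_of_tendsto_charFun hf h
  let m : ℕ → ProbabilityMeasure ℝ := fun i => ⟨μ i, inferInstance⟩
  have h_compact : IsCompact (closure (Set.range m)) := by
    refine isCompact_closure_of_isTightMeasureSet ?_
    convert h_tight using 1
    ext ν
    constructor
    · rintro ⟨_, ⟨i, rfl⟩, rfl⟩
      exact ⟨i, rfl⟩
    · rintro ⟨i, rfl⟩
      exact ⟨m i, ⟨i, rfl⟩, rfl⟩
  let U : Ultrafilter ℕ := Ultrafilter.of atTop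
  have hU : (U : Filter ℕ) ≤ atTop := Ultrafilter.of_le _
  obtain ⟨ν, -, hν⟩ := h_compact.ultrafilter_le_nhds (U.map m) (by
    rw [le_principal_iff]
    exact Filter.mem_of_superset (Filter.mem_map.2 (Filter.Eventually.of_forall
      (fun i => Set.mem_range_self i))) subset_closure)
  have hν' : Tendsto m U (𝓝 ν) := hν
  refine ⟨ν, inferInstance, fun t => tendsto_nhds_unique ?_ ((h t).mono_left hU)⟩
  rw [ProbabilityMeasure.tendsto_iff_forall_integral_rclike_tendsto ℂ] at hν'
  simp_rw [charFun_eq_integral_innerProbChar]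
  exact hν' (BoundedContinuousFunction.innerProbChar t)

/-- The law of `E / R`, where `E` is a standard exponential variable and `R` an independent
uniform variable on `(0, 1]`. -/
noncomputable def expDivUniform : Measure ℝ :=
  ((volume.restrict (Set.Ioc (0 : ℝ) 1)).prod (volume.restrict (Set.Ioc (0 : ℝ) 1))).map
    (fun p => -Real.log p.2 / p.1)

instance : IsProbabilityMeasure (volume.restrict (Set.Ioc (0 : ℝ) 1)) := ⟨by simp⟩

instance : IsProbabilityMeasure expDivUniform :=
  Measure.isProbabilityMeasure_map (by fun_prop)

lemma integral_Ioc_exp_neg_log (s : ℝ) {r : ℝ} (hr : 0 < r) :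
    ∫ u in Set.Ioc (0 : ℝ) 1, cexp (s * ((-Real.log u / r : ℝ) : ℂ) * I) = r / (r - s * I) := by
  have hr' : (r : ℂ) ≠ 0 := by exact_mod_cast hr.ne'
  have h : ∀ u ∈ Set.Ioc (0 : ℝ) 1,
      cexp (s * ((-Real.log u / r : ℝ) : ℂ) * I) = (u : ℂ) ^ (-(s / r * I) : ℂ) := by
    intro u hu
    rw [cpow_def_of_ne_zero (by exact_mod_cast hu.1.ne'), ← ofReal_log hu.1.le]
    push_cast
    congr 1
    ring
  have hne : (r : ℂ) - s * I ≠ 0 := fun h0 => hr.ne' (by simpa using congrArg re h0)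
  have hre : (-(s / r * I) : ℂ).re = 0 := by
    rw [← ofReal_div]; simp
  have h1 : (-(s / r * I) + 1 : ℂ) ≠ 0 := fun h0 => by
    have := congrArg re h0
    rw [add_re, hre] at this
    simp at this
  rw [setIntegral_congr_fun measurableSet_Ioc h, ← intervalIntegral.integral_of_le zero_le_one,
    integral_cpow (Or.inl (by rw [hre]; norm_num))]
  rw [Complex.ofReal_one, one_cpow, Complex.ofReal_zero, zero_cpow h1, div_eq_div_iff h1 hne]
  field_simp
  ring

lemma integral_Ioc_div_sub_mul_I {s : ℝ} (hs : s ≠ 0) :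
    ∫ r in Set.Ioc (0 : ℝ) 1, (r : ℂ) / (r - s * I) =
      1 + s * I * (log (1 - s * I) - log (-(s * I))) := by
  have hsl : ∀ r : ℝ, (r : ℂ) - s * I ∈ slitPlane := fun r => Or.inr (by simpa using hs)
  have hne : ∀ r : ℝ, (r : ℂ) - s * I ≠ 0 := fun r => slitPlane_ne_zero (hsl r)
  have hd : ∀ r ∈ Set.uIcc (0 : ℝ) 1, HasDerivAt
      (fun r : ℝ => (r : ℂ) + s * I * log (r - s * I)) ((r : ℂ) / (r - s * I)) r := by
    intro r _
    have h1 : HasDerivAt (fun r : ℝ => (r : ℂ)) 1 r := ofRealCLM.hasDerivAt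
    have h2 : HasDerivAt (fun r : ℝ => (r : ℂ) + s * I * log (r - s * I))
        (1 + s * I * (1 / (r - s * I))) r :=
      h1.add (((h1.sub_const (s * I)).clog_real (hsl r)).const_mul (s * I : ℂ))
    have := hne r
    exact h2.congr_deriv (by field_simp; ring)
  rw [← intervalIntegral.integral_of_le zero_le_one, intervalIntegral.integral_eq_sub_of_hasDerivAt hd]
  · simp
    ring
  · apply Continuous.intervalIntegrable
    exact continuous_ofReal.div (by fun_prop) hne

lemma log_neg_mul_I {s : ℝ} (hs : s ≠ 0) :
    (s : ℂ) * I * log (-(s * I)) = Real.pi / 2 * |s| + s * Real.log s * I := by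
  rcases lt_or_gt_of_ne hs with h | h
  · have : (-(s * I) : ℂ) = ((-s : ℝ) : ℂ) * I := by push_cast; ring
    rw [this, log_ofReal_mul (by linarith) I_ne_zero, log_I, abs_of_neg h, Real.log_neg_eq_log]
    push_cast
    linear_combination (s * Real.pi / 2 : ℂ) * I_sq
  · have : (-(s * I) : ℂ) = (s : ℂ) * (-I) := by ring
    rw [this, log_ofReal_mul h (by simp), log_neg_I, abs_of_pos h]
    linear_combination -(s * Real.pi / 2 : ℂ) * I_sq

lemma charFun_expDivUniform (s : ℝ) :
    charFun expDivUniform s =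
      1 + (-(Real.pi / 2 * |s|) - s * Real.log s * I) + s * log (1 - s * I) * I := by
  rcases eq_or_ne s 0 with rfl | hs
  · simp
  rw [charFun_apply_real, expDivUniform, integral_map (by fun_prop) (by fun_prop),
    integral_prod]
  · have : ∀ r ∈ Set.Ioc (0 : ℝ) 1, ∫ u in Set.Ioc (0 : ℝ) 1,
        cexp (s * ((-Real.log u / r : ℝ) : ℂ) * I) = r / (r - s * I) :=
      fun r hr => integral_Ioc_exp_neg_log s hr.1
    rw [setIntegral_congr_fun measurableSet_Ioc this, integral_Ioc_div_sub_mul_I hs, mul_sub,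
      log_neg_mul_I hs]
    ring
  · refine (integrable_const (1 : ℝ)).mono (Measurable.aestronglyMeasurable (by fun_prop))
      (ae_of_all _ fun p => ?_)
    rw [← Complex.ofReal_mul, norm_exp_ofReal_mul_I]
    simp

lemma tendsto_nat_mul_one_add_add_mul_exp_neg_sub_one {b c : ℕ → ℂ} {w : ℂ}
    (hb : Tendsto (fun m : ℕ => m * ‖b m‖ ^ 2) atTop (𝓝 0))
    (hc : Tendsto (fun m : ℕ => m * c m) atTop (𝓝 w)) :
    Tendsto (fun m : ℕ => m * ((1 + b m + c m) * cexp (-b m) - 1)) atTop (𝓝 w) := by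
  have hb0 : Tendsto (fun m => ‖b m‖ ^ 2) atTop (𝓝 0) := by
    refine squeeze_zero' (Eventually.of_forall fun m => by positivity) ?_ hb
    filter_upwards [eventually_ge_atTop 1] with m hm
    have : (1 : ℝ) ≤ m := by exact_mod_cast hm
    nlinarith [sq_nonneg ‖b m‖]
  have hb1 : Tendsto b atTop (𝓝 0) := by
    rw [tendsto_zero_iff_norm_tendsto_zero]
    simpa using hb0.sqrt
  have he : Tendsto (fun m => cexp (-b m)) atTop (𝓝 1) := by
    simpa using hb1.neg.cexp
  have h1 : Tendsto (fun m : ℕ => (m : ℂ) * (cexp (b m) - 1 - b m)) atTop (𝓝 0) := by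
    rw [tendsto_zero_iff_norm_tendsto_zero]
    refine squeeze_zero' (Eventually.of_forall fun m => norm_nonneg _) ?_ hb
    have : ∀ᶠ m in atTop, ‖b m‖ < 1 := by
      simpa using hb1.norm.eventually_lt_const (by simp)
    filter_upwards [this] with m hm
    rw [norm_mul, Complex.norm_natCast]
    gcongr
    exact norm_exp_sub_one_sub_id_le hm.le
  have h2 := (hc.mul he).sub (h1.mul he)
  rw [mul_one, zero_mul, sub_zero] at h2
  refine h2.congr fun m => ?_
  have : cexp (b m) * cexp (-b m) = 1 := by rw [← Complex.exp_add]; simp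
  linear_combination (-m : ℂ) * this

lemma tendsto_charFun_expDivUniform_pow (s : ℝ) :
    Tendsto (fun m : ℕ => charFun expDivUniform (s / m) ^ m * cexp (-(s * Real.log m * I)))
      atTop (𝓝 (cexp (-(Real.pi / 2 * |s|) - s * Real.log s * I))) := by
  rcases eq_or_ne s 0 with rfl | hs
  · simp
  let b : ℕ → ℂ := fun m => s / m * Real.log m * I
  let c : ℕ → ℂ := fun m =>
    (-(Real.pi / 2 * |s|) - s * Real.log s * I + s * log (1 - (s / m : ℝ) * I) * I) / m
  have hb : Tendsto (fun m : ℕ => m * ‖b m‖ ^ 2) atTop (𝓝 0) := by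
    have h := (Real.isLittleO_pow_log_id_atTop (n := 2)).tendsto_div_nhds_zero.comp
      (tendsto_natCast_atTop_atTop (R := ℝ))
    have h' := h.const_mul (s ^ 2)
    rw [mul_zero] at h'
    refine h'.congr' ?_
    filter_upwards [eventually_ge_atTop 1] with m hm
    have : (m : ℝ) ≠ 0 := by positivity
    simp only [b, norm_mul, norm_div, norm_real, Complex.norm_natCast, norm_I, Function.comp_apply, id,
      mul_one, mul_pow, div_pow, Real.norm_eq_abs, sq_abs]
    field_simp
  have hc : Tendsto (fun m : ℕ => m * c m) atTop
      (𝓝 (-(Real.pi / 2 * |s|) - s * Real.log s * I)) := by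
    have h0 : Tendsto (fun m : ℕ => s / m) atTop (𝓝 0) :=
      tendsto_const_nhds.div_atTop tendsto_natCast_atTop_atTop
    have h1 : ContinuousAt (fun x : ℝ => -(Real.pi / 2 * |s|) - s * Real.log s * I
        + s * log (1 - x * I) * I) 0 := by
      refine continuousAt_const.add (((continuousAt_const.mul ?_)).mul continuousAt_const)
      refine ContinuousAt.clog (by fun_prop) ?_
      simp
    have h2 := h1.tendsto.comp h0
    simp only [Complex.ofReal_zero, zero_mul, sub_zero, Complex.log_one, mul_zero, add_zero] at h2
    refine h2.congr' ?_
    filter_upwards [eventually_ge_atTop 1] with m hm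
    have : (m : ℂ) ≠ 0 := by exact_mod_cast (by omega : m ≠ 0)
    simp only [c, Function.comp_apply]
    field_simp
  refine (tendsto_one_add_pow_exp_of_tendsto
    (tendsto_nat_mul_one_add_add_mul_exp_neg_sub_one hb hc)).congr' ?_
  filter_upwards [eventually_ge_atTop 1] with m hm
  have hm0 : (m : ℂ) ≠ 0 := by exact_mod_cast (by omega : m ≠ 0)
  have hmr : (0 : ℝ) < m := by exact_mod_cast hm
  have h1 : charFun expDivUniform (s / m) = 1 + b m + c m := by
    rw [charFun_expDivUniform, Real.log_div hs hmr.ne', abs_div, abs_of_pos hmr]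
    simp only [b, c]
    push_cast
    field_simp
    ring
  have h2 : cexp (-(s * Real.log m * I)) = cexp (-b m) ^ m := by
    rw [← Complex.exp_nat_mul]
    congr 1
    simp only [b]
    field_simp
  rw [h1, h2, ← mul_pow]
  congr 1
  ring

/-- The totally skewed `1`-stable law exists. -/
lemma exists_charFun_eq_skewed_stable :
    ∃ ν : Measure ℝ, IsProbabilityMeasure ν ∧
      ∀ s, charFun ν s = cexp (-(Real.pi / 2 * |s|) - s * Real.log s * I) := by
  choose ν hν hν' using exists_probabilityMeasure_charFun_eq_pow expDivUniform
  let μ : ℕ → Measure ℝ := fun m =>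
    ((ν m).map ((m : ℝ)⁻¹ * ·)).map (· + (-Real.log m))
  have : ∀ m, IsProbabilityMeasure (μ m) := fun m =>
    have := Measure.isProbabilityMeasure_map (μ := ν m) (f := ((m : ℝ)⁻¹ * ·)) (by fun_prop)
    Measure.isProbabilityMeasure_map (by fun_prop)
  refine exists_probabilityMeasure_of_tendsto_charFun (μ := μ) ?_ fun s => ?_
  · have := Real.continuous_mul_log
    have h : Continuous fun s : ℝ =>
        cexp (-(Real.pi / 2 * |s|) - ((s * Real.log s : ℝ) : ℂ) * I) := by fun_prop
    simpa using h.continuousAt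
  · refine (tendsto_charFun_expDivUniform_pow s).congr fun m => ?_
    simp only [μ]
    rw [charFun_map_add_const, charFun_map_mul, hν', inv_mul_eq_div]
    congr 2
    simp

lemma integral_exp_mul_I_mul_exp_neg_two_pi_abs (w : ℝ) :
    Integrable (fun v : ℝ => (Real.exp (-2 * Real.pi * |v|) : ℂ)) ∧
    ∫ v : ℝ, cexp (((-2 * Real.pi * v * w : ℝ) : ℂ) * I) * Real.exp (-2 * Real.pi * |v|) =
      (((Real.pi * (1 + w ^ 2))⁻¹ : ℝ) : ℂ) := by
  have hpi := Real.pi_pos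
  have e1 : ∀ u : ℝ, ∀ v ∈ Set.Iic (0 : ℝ),
      cexp (((-2 * Real.pi * v * u : ℝ) : ℂ) * I) * Real.exp (-2 * Real.pi * |v|) =
      cexp ((2 * Real.pi * (1 - u * I)) * v) := by
    intro u v hv
    rw [abs_of_nonpos hv, ofReal_exp, ← Complex.exp_add]
    congr 1; push_cast; ring
  have e2 : ∀ u : ℝ, ∀ v ∈ Set.Ioi (0 : ℝ),
      cexp (((-2 * Real.pi * v * u : ℝ) : ℂ) * I) * Real.exp (-2 * Real.pi * |v|) =
      cexp ((-(2 * Real.pi * (1 + u * I))) * v) := by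
    intro u v hv
    rw [abs_of_pos hv, ofReal_exp, ← Complex.exp_add]
    congr 1; push_cast; ring
  have p1 : ∀ u : ℝ, 0 < (2 * Real.pi * (1 - u * I) : ℂ).re := fun u => by simpa using hpi
  have p2 : ∀ u : ℝ, (-(2 * Real.pi * (1 + u * I)) : ℂ).re < 0 := fun u => by simpa using hpi
  have i1 : ∀ u : ℝ, IntegrableOn (fun v : ℝ =>
      cexp (((-2 * Real.pi * v * u : ℝ) : ℂ) * I) * Real.exp (-2 * Real.pi * |v|)) (Set.Iic 0) :=
    fun u => (integrableOn_exp_mul_complex_Iic (p1 u) 0).congr_fun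
      (fun v hv => (e1 u v hv).symm) measurableSet_Iic
  have i2 : ∀ u : ℝ, IntegrableOn (fun v : ℝ =>
      cexp (((-2 * Real.pi * v * u : ℝ) : ℂ) * I) * Real.exp (-2 * Real.pi * |v|)) (Set.Ioi 0) :=
    fun u => (integrableOn_exp_mul_complex_Ioi (p2 u) 0).congr_fun
      (fun v hv => (e2 u v hv).symm) measurableSet_Ioi
  constructor
  · have := (i1 0).union (i2 0)
    rw [Set.Iic_union_Ioi, integrableOn_univ] at this
    simpa using this
  · rw [← intervalIntegral.integral_Iic_add_Ioi (i1 w) (i2 w),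
      setIntegral_congr_fun measurableSet_Iic (e1 w), setIntegral_congr_fun measurableSet_Ioi (e2 w),
      integral_exp_mul_complex_Iic (p1 w), integral_exp_mul_complex_Ioi (p2 w)]
    have hpc : (Real.pi : ℂ) ≠ 0 := by exact_mod_cast hpi.ne'
    have n1 : (1 - w * I : ℂ) ≠ 0 := fun h => by simpa using congrArg re h
    have n2 : (1 + w * I : ℂ) ≠ 0 := fun h => by simpa using congrArg re h
    have n3 : (1 + w ^ 2 : ℂ) ≠ 0 := by
      have : (1 + w ^ 2 : ℂ) = (1 - w * I) * (1 + w * I) := by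
        linear_combination (w ^ 2 : ℂ) * I_sq
      rw [this]; exact mul_ne_zero n1 n2
    push_cast
    simp only [mul_zero, Complex.exp_zero]
    field_simp
    linear_combination (2 * w ^ 2 : ℂ) * I_sq

lemma integrable_inv_pi_mul_one_add_sq :
    Integrable (fun x : ℝ => (Real.pi * (1 + x ^ 2))⁻¹) := by
  simp_rw [mul_inv]
  exact integrable_inv_one_add_sq.const_mul _

lemma integral_stdCauchy {E : Type*} [NormedAddCommGroup E] [NormedSpace ℝ E] (g : ℝ → E) :
    ∫ x, g x ∂stdCauchy = ∫ x, (Real.pi * (1 + x ^ 2))⁻¹ • g x := by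
  rw [stdCauchy, integral_withDensity_eq_integral_toReal_smul (by fun_prop) (by simp)]
  refine integral_congr_ae (ae_of_all _ fun x => ?_)
  have : 0 ≤ (Real.pi * (1 + x ^ 2))⁻¹ := by positivity
  simp only [ENNReal.toReal_ofReal this]

lemma charFun_stdCauchy (s : ℝ) : charFun stdCauchy s = Real.exp (-|s|) := by
  let g : ℝ → ℂ := fun v => Real.exp (-2 * Real.pi * |v|)
  have hF : 𝓕 g = fun w : ℝ => (((Real.pi * (1 + w ^ 2))⁻¹ : ℝ) : ℂ) := by
    ext w
    rw [Real.fourier_real_eq_integral_exp_smul]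
    exact (integral_exp_mul_I_mul_exp_neg_two_pi_abs w).2
  have hg : Continuous g := by fun_prop
  have hinv := hg.fourierInv_fourier_eq (integral_exp_mul_I_mul_exp_neg_two_pi_abs 0).1
    (by rw [hF]; exact integrable_inv_pi_mul_one_add_sq.ofReal)
  have hpi := Real.pi_pos
  have h := congrFun hinv (s / (2 * Real.pi))
  rw [Real.fourierInv_eq', hF] at h
  have hgs : g (s / (2 * Real.pi)) = Real.exp (-|s|) := by
    simp only [g, abs_div, abs_of_pos (by positivity : 0 < 2 * Real.pi)]
    congr 2
    field_simp
  rw [charFun_apply_real, integral_stdCauchy, ← hgs, ← h]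
  refine integral_congr_ae (ae_of_all _ fun x => ?_)
  simp only [real_smul, smul_eq_mul]
  rw [mul_comm]
  congr 2
  simp
  field_simp

instance : IsProbabilityMeasure stdCauchy := by
  have h : stdCauchy.real Set.univ = 1 := by
    have := charFun_zero stdCauchy
    rw [charFun_stdCauchy] at this
    simpa using this.symm
  exact ⟨by rwa [Measure.real, ENNReal.toReal_eq_one_iff] at h⟩

lemma measurableSet_sum_eq (n : ℕ) (C : ℝ) : MeasurableSet {x : Fin n → ℝ | ∑ i, x i = C} :=
  measurableSet_eq_fun (by fun_prop) measurable_const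

lemma isJointMix_stdCauchy_log {n : ℕ} (hn : 2 ≤ n) :
    IsJointMix n (fun _ => stdCauchy) (n * (Real.log ((n : ℝ) - 1) / Real.pi)) := by
  obtain ⟨ν, hν, hν'⟩ := exists_charFun_eq_skewed_stable
  have hpi := Real.pi_pos
  have hn1 : (0 : ℝ) < n - 1 := by
    have : (2 : ℝ) ≤ n := by exact_mod_cast hn
    linarith
  let a : ℝ := Real.pi⁻¹
  let q : ℝ := -(Real.pi⁻¹ / (n - 1))
  let k : ℝ := Real.log ((n : ℝ) - 1) / Real.pi
  let L : (Fin n → ℝ) → Fin n → ℝ := fun x j => ∑ i, (if i = j then a else q) * x i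
  let X : (Fin n → ℝ) → Fin n → ℝ := fun x j => L x j + k
  have hLj : ∀ j, Measurable fun x => L x j := fun j => by fun_prop
  have hX : Measurable X := by fun_prop
  have hsum : ∀ {M : Type} [AddCommGroup M] (j : Fin n) (u v : M),
      (∑ i, if i = j then u else v) = u + (n - 1) • v := by
    intro M _ j u v
    rw [Finset.sum_ite, Finset.sum_const, Finset.sum_const, Finset.filter_eq' ,
      Finset.filter_ne']
    simp
  let P : Measure (Fin n → ℝ) := Measure.pi fun _ => ν
  have hPX : IsProbabilityMeasure (P.map X) := Measure.isProbabilityMeasure_map hX.aemeasurable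
  refine ⟨P.map X, hPX, fun j => ?_, ?_⟩
  · rw [Measure.map_map (by fun_prop) hX]
    have : IsProbabilityMeasure (P.map ((fun x => x j) ∘ X)) :=
      Measure.isProbabilityMeasure_map (by fun_prop)
    refine Measure.ext_of_charFun (funext fun s => ?_)
    have h1 : P.map ((fun x => x j) ∘ X) = (P.map fun x => L x j).map (· + k) := by
      rw [Measure.map_map (by fun_prop) (hLj j)]
      rfl
    have h2 : charFun (P.map fun x => L x j) s =
        ∏ i, charFun ν ((if i = j then a else q) * s) := by
      simp_rw [charFun_apply_real]
      rw [integral_map (hLj j).aemeasurable (by fun_prop)]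
      rw [← integral_fintype_prod_eq_prod
        (f := fun i (x : ℝ) => cexp (((if i = j then a else q) * s : ℝ) * x * I))]
      refine integral_congr_ae (ae_of_all _ fun x => ?_)
      simp only [L]
      rw [← Complex.exp_sum]
      congr 1
      push_cast
      rw [Finset.mul_sum, Finset.sum_mul]
      refine Finset.sum_congr rfl fun i _ => ?_
      ring
    rw [h1, charFun_map_add_const, h2, charFun_stdCauchy]
    rcases eq_or_ne s 0 with rfl | hs
    · simp
    simp_rw [hν']
    rw [← Complex.exp_sum, ← Complex.exp_add, ofReal_exp]
    congr 1
    have h3 : ∀ i, (-(Real.pi / 2 * |((if i = j then a else q) * s : ℝ)|)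
        - ((if i = j then a else q) * s : ℝ) * Real.log ((if i = j then a else q) * s) * I : ℂ)
        = if i = j then -(Real.pi / 2 * |(a * s : ℝ)|) - (a * s : ℝ) * Real.log (a * s) * I
          else -(Real.pi / 2 * |(q * s : ℝ)|) - (q * s : ℝ) * Real.log (q * s) * I := by
      intro i
      split_ifs <;> rfl
    rw [Finset.sum_congr rfl fun i _ => h3 i, hsum]
    have ha : 0 < a := by positivity
    have hq : 0 < Real.pi⁻¹ / (n - 1 : ℝ) := by positivity
    have hlq : Real.log (q * s) = Real.log (a * s) - Real.log ((n : ℝ) - 1) := by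
      simp only [q, a]
      rw [neg_mul, Real.log_neg_eq_log, div_mul_eq_mul_div, Real.log_div _ hn1.ne']
      exact mul_ne_zero ha.ne' hs
    have haq : |q * s| = Real.pi⁻¹ / (n - 1) * |s| := by
      rw [abs_mul, abs_neg, abs_of_pos hq]
    have haa : |a * s| = Real.pi⁻¹ * |s| := by rw [abs_mul, abs_of_pos ha]
    rw [hlq, haq, haa]
    have hc : ((n - 1 : ℕ) : ℂ) = n - 1 := by push_cast [Nat.cast_sub (by omega : 1 ≤ n)]; rfl
    have hnc : (n - 1 : ℂ) ≠ 0 := by exact_mod_cast hn1.ne'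
    have hpc : (Real.pi : ℂ) ≠ 0 := by exact_mod_cast hpi.ne'
    rw [nsmul_eq_mul, hc]
    simp only [q, a, k]
    simp
    field_simp
    ring
  · rw [Measure.map_apply hX (measurableSet_sum_eq _ _)]
    convert measure_univ (μ := P)
    refine Set.eq_univ_of_forall fun x => ?_
    simp only [Set.mem_preimage, Set.mem_ofPred_eq, X, L]
    rw [Finset.sum_add_distrib, Finset.sum_comm]
    have h0 : ∀ i, ∑ j, (if i = j then a else q) * x i = 0 := by
      intro i
      simp_rw [eq_comm (a := i)]
      rw [← Finset.sum_mul, hsum, nsmul_eq_mul, Nat.cast_sub (by omega : 1 ≤ n)]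
      simp only [a, q]
      field_simp
      simp
    rw [Finset.sum_congr rfl fun i _ => h0 i]
    simp [k]

lemma map_neg_stdCauchy : stdCauchy.map (fun x => -x) = stdCauchy := by
  have := Measure.isProbabilityMeasure_map (μ := stdCauchy) (f := fun x => -x) (by fun_prop)
  refine Measure.ext_of_charFun (funext fun s => ?_)
  have h : stdCauchy.map (fun x => -x) = stdCauchy.map (fun x => (-1) * x) := by simp
  rw [h, charFun_map_mul, charFun_stdCauchy, charFun_stdCauchy]
  simp

lemma IsJointMix.neg_stdCauchy {n : ℕ} {C : ℝ} (h : IsJointMix n (fun _ => stdCauchy) C) :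
    IsJointMix n (fun _ => stdCauchy) (-C) := by
  obtain ⟨P, hP, hm, hs⟩ := h
  refine ⟨P.map fun x => -x, Measure.isProbabilityMeasure_map (by fun_prop), fun j => ?_, ?_⟩
  · have hmj : P.map (fun x => x j) = stdCauchy := hm j
    rw [← map_neg_stdCauchy, ← hmj, Measure.map_map (by fun_prop) (by fun_prop),
      Measure.map_map (by fun_prop) (by fun_prop)]
    rfl
  · rw [Measure.map_apply (by fun_prop) (measurableSet_sum_eq _ _)]
    convert hs using 2
    ext x
    simp

lemma IsJointMix.convex_stdCauchy {n : ℕ} {C D α β : ℝ} (hα : 0 ≤ α) (hβ : 0 ≤ β) (hαβ : α + β = 1)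
    (hC : IsJointMix n (fun _ => stdCauchy) C) (hD : IsJointMix n (fun _ => stdCauchy) D) :
    IsJointMix n (fun _ => stdCauchy) (α * C + β * D) := by
  obtain ⟨P, hP, hPm, hPs⟩ := hC
  obtain ⟨Q, hQ, hQm, hQs⟩ := hD
  let F : (Fin n → ℝ) × (Fin n → ℝ) → Fin n → ℝ := fun z j => α * z.1 j + β * z.2 j
  have hF : Measurable F := by fun_prop
  refine ⟨(P.prod Q).map F, Measure.isProbabilityMeasure_map hF.aemeasurable, fun j => ?_, ?_⟩
  · rw [Measure.map_map (by fun_prop) hF]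
    have : IsProbabilityMeasure ((P.prod Q).map ((fun x => x j) ∘ F)) :=
      Measure.isProbabilityMeasure_map (by fun_prop)
    refine Measure.ext_of_charFun (funext fun s => ?_)
    have hPj : P.map (fun x => x j) = stdCauchy := hPm j
    have hQj : Q.map (fun x => x j) = stdCauchy := hQm j
    have hP' : ∫ x, cexp ((α * s : ℝ) * x j * I) ∂P = charFun stdCauchy (α * s) := by
      rw [← hPj, charFun_apply_real,
        integral_map (measurable_pi_apply j).aemeasurable (by fun_prop)]
    have hQ' : ∫ x, cexp ((β * s : ℝ) * x j * I) ∂Q = charFun stdCauchy (β * s) := by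
      rw [← hQj, charFun_apply_real,
        integral_map (measurable_pi_apply j).aemeasurable (by fun_prop)]
    rw [charFun_apply_real, integral_map (by fun_prop) (by fun_prop)]
    trans ∫ z, cexp ((α * s : ℝ) * z.1 j * I) * cexp ((β * s : ℝ) * z.2 j * I) ∂(P.prod Q)
    · refine integral_congr_ae (ae_of_all _ fun z => ?_)
      simp only [F, Function.comp_apply]
      rw [← Complex.exp_add]
      congr 1
      push_cast
      ring
    · rw [integral_prod_mul (fun x : Fin n → ℝ => cexp ((α * s : ℝ) * x j * I))
        (fun x : Fin n → ℝ => cexp ((β * s : ℝ) * x j * I)), hP', hQ', charFun_stdCauchy,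
        charFun_stdCauchy, charFun_stdCauchy, ← Complex.ofReal_mul, ← Real.exp_add, abs_mul,
        abs_mul, abs_of_nonneg hα, abs_of_nonneg hβ]
      congr 2
      linear_combination (-|s|) * hαβ
  · rw [Measure.map_apply hF (measurableSet_sum_eq _ _)]
    have hle : {x : Fin n → ℝ | ∑ i, x i = C} ×ˢ {x : Fin n → ℝ | ∑ i, x i = D} ⊆
        F ⁻¹' {x | ∑ i, x i = α * C + β * D} := by
      rintro ⟨x, y⟩ ⟨hx, hy⟩
      simp only [Set.mem_ofPred_eq] at hx hy
      simp only [F, Set.mem_preimage, Set.mem_ofPred_eq]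
      rw [Finset.sum_add_distrib, ← Finset.mul_sum, ← Finset.mul_sum, hx, hy]
    refine le_antisymm prob_le_one ?_
    refine le_trans ?_ (measure_mono hle)
    rw [Measure.prod_prod, hPs, hQs, one_mul]

lemma isJointMix_stdCauchy_of_abs_le {n : ℕ} (hn : 2 ≤ n) {C : ℝ}
    (hC : |C| ≤ n * Real.log ((n : ℝ) - 1) / Real.pi) :
    IsJointMix n (fun _ => stdCauchy) C := by
  have h1 := isJointMix_stdCauchy_log hn
  rw [← mul_div_assoc] at h1
  set K := n * Real.log ((n : ℝ) - 1) / Real.pi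
  obtain ⟨hl, hu⟩ := abs_le.1 hC
  have hmem : C ∈ segment ℝ (-K) K := by
    rw [segment_eq_Icc (by linarith)]
    exact ⟨hl, hu⟩
  obtain ⟨α, β, hα, hβ, hαβ, rfl⟩ := hmem
  exact h1.neg_stdCauchy.convex_stdCauchy hα hβ hαβ h1

lemma integral_Ioc_div_one_add_sq {b : ℝ} (hb : 0 ≤ b) :
    ∫ x in Set.Ioc 0 b, x / (1 + x ^ 2) = Real.log (1 + b ^ 2) / 2 := by
  rw [← intervalIntegral.integral_of_le hb,
    intervalIntegral.integral_eq_sub_of_hasDerivAt (f := fun x => Real.log (1 + x ^ 2) / 2)]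
  · simp
  · intro x _
    have h1 : HasDerivAt (fun x : ℝ => 1 + x ^ 2) (2 * x) x := by
      simpa using (hasDerivAt_pow 2 x).const_add 1
    exact ((h1.log (by positivity)).div_const 2).congr_deriv (by field_simp)
  · refine Continuous.intervalIntegrable ?_ _ _
    exact continuous_id.div (by fun_prop) fun x => by positivity

/-- The truncated first moment of the positive part of the standard Cauchy distribution. -/
lemma integral_min_max_stdCauchy {b : ℝ} (hb : 0 ≤ b) :
    ∫ x, min (max x 0) b ∂stdCauchy =
      Real.pi⁻¹ * (Real.log (1 + b ^ 2) / 2 + b * (Real.pi / 2 - Real.arctan b)) := by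
  have h : ∀ x : ℝ, (Real.pi * (1 + x ^ 2))⁻¹ • min (max x 0) b =
      (Set.Ioc 0 b).indicator (fun x => Real.pi⁻¹ * (x / (1 + x ^ 2))) x +
      (Set.Ioi b).indicator (fun x => Real.pi⁻¹ * (b * (1 + x ^ 2)⁻¹)) x := by
    intro x
    rw [smul_eq_mul, mul_inv]
    rcases le_or_gt x 0 with hx | hx
    · rw [Set.indicator_of_notMem (by simp [hx]), Set.indicator_of_notMem (by simp; linarith),
        max_eq_right hx, min_eq_left hb]
      simp
    rcases le_or_gt x b with hxb | hxb
    · rw [Set.indicator_of_mem (by simp [hx, hxb]), Set.indicator_of_notMem (by simp [hxb]),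
        max_eq_left hx.le, min_eq_left hxb]
      ring
    · rw [Set.indicator_of_notMem (by simp [hxb]), Set.indicator_of_mem (by simp [hxb]),
        max_eq_left hx.le, min_eq_right hxb.le]
      ring
  have hc : Continuous fun x : ℝ => Real.pi⁻¹ * (x / (1 + x ^ 2)) :=
    continuous_const.mul (continuous_id.div (by fun_prop) fun x => by positivity)
  rw [integral_stdCauchy]
  simp_rw [h]
  rw [integral_add, integral_indicator measurableSet_Ioc, integral_indicator measurableSet_Ioi,
    integral_const_mul, integral_const_mul, integral_const_mul, integral_Ioc_div_one_add_sq hb,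
    integral_Ioi_inv_one_add_sq, mul_add]
  · exact (integrable_indicator_iff measurableSet_Ioc).2
      ((hc.integrableOn_Icc).mono_set Set.Ioc_subset_Icc_self)
  · exact (integrable_indicator_iff measurableSet_Ioi).2
      ((integrable_inv_one_add_sq.const_mul b).const_mul _).integrableOn

lemma integrable_max_min (μ : Measure ℝ) [IsProbabilityMeasure μ] (a b : ℝ) :
    Integrable (fun x => max a (min x b)) μ := by
  refine Integrable.of_bound (C := |a| + |b|) (by fun_prop) (ae_of_all _ fun x => ?_)
  rw [Real.norm_eq_abs, abs_le]
  constructor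
  · linarith [le_max_left a (min x b), neg_abs_le a, abs_nonneg b]
  · exact max_le (by linarith [le_abs_self a, abs_nonneg b])
      ((min_le_right _ _).trans (by linarith [le_abs_self b, abs_nonneg a]))

lemma integrable_min_max_zero (μ : Measure ℝ) [IsProbabilityMeasure μ] {b : ℝ} (hb : 0 ≤ b) :
    Integrable (fun x => min (max x 0) b) μ := by
  refine Integrable.of_bound (C := b) (by fun_prop) (ae_of_all _ fun x => ?_)
  rw [Real.norm_eq_abs, abs_of_nonneg (le_min (le_max_right _ _) hb)]
  exact min_le_right _ _

lemma integral_clamp_stdCauchy {a b : ℝ} (ha : 0 ≤ a) (hb : 0 ≤ b) :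
    ∫ x, max (-a) (min x b) ∂stdCauchy =
      ∫ x, min (max x 0) b ∂stdCauchy - ∫ x, min (max x 0) a ∂stdCauchy := by
  have h2 : ∫ x, min (max x 0) a ∂stdCauchy = ∫ x, min (max (-x) 0) a ∂stdCauchy := by
    conv_lhs => rw [← map_neg_stdCauchy]
    rw [integral_map (by fun_prop) (by fun_prop)]
  have hi : Integrable (fun x => min (max (-x) 0) a) stdCauchy := by
    have := integrable_min_max_zero stdCauchy ha
    rw [← map_neg_stdCauchy] at this
    exact this.comp_measurable (by fun_prop)
  rw [h2, ← integral_sub (integrable_min_max_zero _ hb) hi]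
  refine integral_congr_ae (ae_of_all _ fun x => ?_)
  simp only
  grind

/-- Truncating the coordinates at `-a` and `(n - 1) a + C` does not decrease a sum equal to `C`. -/
lemma le_sum_clamp {n : ℕ} {a C : ℝ} (x : Fin n → ℝ) (hx : ∑ i, x i = C) :
    C ≤ ∑ i, max (-a) (min (x i) ((n - 1) * a + C)) := by
  by_cases h : ∀ i, x i ≤ (n - 1) * a + C
  · rw [← hx]
    refine Finset.sum_le_sum fun i _ => ?_
    rw [hx, min_eq_left (h i)]
    exact le_max_right _ _
  · push Not at h
    obtain ⟨j, hj⟩ := h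
    have h1 : ∑ i, (if i = j then (n - 1) * a + C else -a) = C := by
      rw [Finset.sum_ite, Finset.sum_const, Finset.sum_const, Finset.filter_eq', Finset.filter_ne']
      have : 1 ≤ n := by have := j.2; omega
      simp [Nat.cast_sub this]
    conv_lhs => rw [← h1]
    refine Finset.sum_le_sum fun i _ => ?_
    split_ifs with hij
    · rw [hij, min_eq_right hj.le]
      exact le_max_right _ _
    · exact le_max_left _ _

lemma IsJointMix.le_integral_clamp {n : ℕ} {μ : Measure ℝ} [IsProbabilityMeasure μ] {a C : ℝ}
    (h : IsJointMix n (fun _ => μ) C) :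
    C ≤ n * ∫ x, max (-a) (min x ((n - 1) * a + C)) ∂μ := by
  obtain ⟨P, hP, hm, hs⟩ := h
  have hi : ∀ i : Fin n, Integrable (fun x => max (-a) (min (x i) ((n - 1) * a + C))) P := by
    intro i
    have hmi : P.map (fun x => x i) = μ := hm i
    have := integrable_max_min μ (-a) ((n - 1) * a + C)
    rw [← hmi] at this
    exact this.comp_measurable (by fun_prop)
  have hint : ∀ i : Fin n, ∫ x, max (-a) (min (x i) ((n - 1) * a + C)) ∂P =
      ∫ x, max (-a) (min x ((n - 1) * a + C)) ∂μ := by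
    intro i
    have hmi : P.map (fun x => x i) = μ := hm i
    rw [← hmi, integral_map (measurable_pi_apply i).aemeasurable (by fun_prop)]
  have hae : ∀ᵐ x ∂P, ∑ i, x i = C :=
    (mem_ae_iff_prob_eq_one (measurableSet_sum_eq n C)).2 hs
  calc C = ∫ _, C ∂P := by simp
    _ ≤ ∫ x, ∑ i, max (-a) (min (x i) ((n - 1) * a + C)) ∂P :=
      integral_mono_ae (integrable_const _) (integrable_finsetSum _ fun i _ => hi i)
        (hae.mono fun x hx => le_sum_clamp x hx)
    _ = n * ∫ x, max (-a) (min x ((n - 1) * a + C)) ∂μ := by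
      rw [integral_finsetSum _ fun i _ => hi i]
      simp [hint]

lemma tendsto_mul_pi_div_two_sub_arctan :
    Tendsto (fun b : ℝ => b * (Real.pi / 2 - Real.arctan b)) atTop (𝓝 1) := by
  have h := (Real.hasDerivAt_arctan 0).tendsto_slope_zero
  have h2 : Tendsto (fun b : ℝ => b⁻¹) atTop (𝓝[≠] 0) :=
    tendsto_inv_atTop_nhdsGT_zero.mono_right (nhdsWithin_mono _ fun x hx => ne_of_gt hx)
  have h3 := h.comp h2
  norm_num at h3
  refine h3.congr' ?_
  filter_upwards [eventually_gt_atTop 0] with b hb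
  simp [Real.arctan_inv_of_pos hb]

lemma tendsto_integral_clamp_stdCauchy {r C : ℝ} (hr : 0 < r) :
    Tendsto (fun a : ℝ => ∫ x, max (-a) (min x (r * a + C)) ∂stdCauchy) atTop
      (𝓝 (Real.log r / Real.pi)) := by
  have hb : Tendsto (fun a : ℝ => r * a + C) atTop atTop :=
    tendsto_atTop_add_const_right _ _ (tendsto_id.const_mul_atTop hr)
  have h1 : Tendsto (fun a : ℝ => (1 + (r * a + C) ^ 2) / (1 + a ^ 2)) atTop (𝓝 (r ^ 2)) := by
    have hc : ContinuousAt (fun u : ℝ => (u ^ 2 + (r + C * u) ^ 2) / (u ^ 2 + 1)) 0 :=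
      ContinuousAt.div (by fun_prop) (by fun_prop) (by norm_num)
    have := hc.tendsto.comp tendsto_inv_atTop_zero
    norm_num at this
    refine this.congr' ?_
    filter_upwards [eventually_gt_atTop 0] with a ha
    simp only [Function.comp_apply]
    field_simp
  have h2 := (h1.log (by positivity)).div_const 2
  have h3 := ((h2.add (tendsto_mul_pi_div_two_sub_arctan.comp hb)).sub
    tendsto_mul_pi_div_two_sub_arctan).const_mul Real.pi⁻¹
  have h4 : Real.pi⁻¹ * (Real.log (r ^ 2) / 2 + 1 - 1) = Real.log r / Real.pi := by
    rw [Real.log_pow]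
    push_cast
    ring
  rw [h4] at h3
  refine h3.congr' ?_
  filter_upwards [eventually_ge_atTop 0, hb.eventually_ge_atTop 0] with a ha hba
  rw [integral_clamp_stdCauchy ha hba, integral_min_max_stdCauchy ha,
    integral_min_max_stdCauchy hba, Real.log_div (by positivity) (by positivity)]
  simp only [Function.comp_apply]
  ring

lemma IsJointMix.le_of_stdCauchy {n : ℕ} (hn : 2 ≤ n) {C : ℝ}
    (h : IsJointMix n (fun _ => stdCauchy) C) :
    C ≤ n * Real.log ((n : ℝ) - 1) / Real.pi := by
  have hn1 : (0 : ℝ) < n - 1 := by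
    have : (2 : ℝ) ≤ n := by exact_mod_cast hn
    linarith
  rw [mul_div_assoc]
  exact ge_of_tendsto ((tendsto_integral_clamp_stdCauchy (C := C) hn1).const_mul (n : ℝ))
    (Eventually.of_forall fun a => h.le_integral_clamp)

lemma isJointMix_stdCauchy_iff {n : ℕ} (hn : 2 ≤ n) (C : ℝ) :
    IsJointMix n (fun _ => stdCauchy) C ↔ |C| ≤ n * Real.log ((n : ℝ) - 1) / Real.pi :=
  ⟨fun h => abs_le'.2 ⟨h.le_of_stdCauchy hn, h.neg_stdCauchy.le_of_stdCauchy hn⟩,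
    isJointMix_stdCauchy_of_abs_le hn⟩

end

theorem stmt16 (n : ℕ) (hn : 2 ≤ n) :
    ({c : ℝ | IsCompletelyMixable n stdCauchy c} =
      Set.Icc (-(Real.log ((n : ℝ) - 1) / Real.pi)) (Real.log ((n : ℝ) - 1) / Real.pi)) ∧
    ∀ C : ℝ, IsJointMix n (fun _ => stdCauchy) C ↔
      |C| ≤ n * Real.log ((n : ℝ) - 1) / Real.pi := by
  refine ⟨?_, isJointMix_stdCauchy_iff hn⟩
  ext c
  have hn0 : (0 : ℝ) < n := by
    have : 0 < n := by omega
    exact_mod_cast this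
  rw [Set.mem_ofPred_eq, IsCompletelyMixable, isJointMix_stdCauchy_iff hn, abs_mul,
    abs_of_pos hn0, mul_div_assoc, mul_le_mul_iff_right₀ hn0, abs_le, Set.mem_Icc]
end

section
/- Let n ≥ 2 and let ν be a Borel probability measure on ℝ with a density g with respect to Lebesgue measure such that g is strictly positive, differentiable, symmetric (g(−x) = g(x)), strictly unimodal (g′ > 0 on (−∞,0) and g′ < 0 on (0,∞)), and such that the function x ↦ 1/√(g(x)) is convex on ℝ. Then every real number q satisfying |q| ≤ liminf_{t→∞} ∫_t^{(n−1)t} x·g(x) dx is an n-center of ν. -/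
open MeasureTheory ENNReal

lemma uniform_average_le {k : ℕ} (hk : 2 ≤ k) {φ : ℝ → ℝ} (hφ : Continuous φ) {p T C : ℝ}
    (hpT : p ≤ T)
    (h : ∀ x : Fin k → ℝ, (∀ i, x i ∈ Set.Icc p T) → ∑ i, x i = k * ((p + T) / 2) →
      C ≤ ∑ i, φ (x i)) :
    C * (T - p) ≤ k * ∫ x in p..T, φ x := by
  obtain ⟨l, rfl⟩ : ∃ l, k = l + 1 := ⟨k - 1, by omega⟩
  have hl : (1 : ℝ) ≤ l := by exact_mod_cast (by omega : 1 ≤ l)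
  have hl0 : (l : ℝ) ≠ 0 := by positivity
  set d := T - p with hd
  have hd0 : 0 ≤ d := by linarith
  have hpt : ∀ s ∈ Set.Icc (0 : ℝ) 1,
      C ≤ ∑ j ∈ Finset.range l, φ ((p + d / l * j) + d / l * s) + φ (T + (-d) * s) := by
    intro s hs
    have hs0 := hs.1
    have hs1 := hs.2
    have := h (Fin.snoc (α := fun _ => ℝ) (fun j : Fin l => (p + d / l * j) + d / l * s)
      (T + (-d) * s)) ?_ ?_
    · rw [Fin.sum_univ_castSucc] at this
      simp only [Fin.snoc_castSucc, Fin.snoc_last] at this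
      rwa [Fin.sum_univ_eq_sum_range (fun j : ℕ => φ ((p + d / l * j) + d / l * s))] at this
    · intro i
      refine Fin.lastCases ?_ (fun j => ?_) i
      · simp only [Fin.snoc_last, Set.mem_Icc]
        constructor <;> nlinarith
      · simp only [Fin.snoc_castSucc, Set.mem_Icc]
        have hj : (j : ℝ) + 1 ≤ l := by exact_mod_cast j.2
        have h0 : 0 ≤ d / l := by positivity
        have h1 : d / l * l = d := by field_simp
        have h2 : (0 : ℝ) ≤ j := by positivity
        constructor
        · nlinarith [mul_nonneg h0 h2, mul_nonneg h0 hs0]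
        · nlinarith [mul_le_mul_of_nonneg_left (show (j : ℝ) + s ≤ l by linarith) h0]
    · rw [Fin.sum_univ_castSucc]
      simp only [Fin.snoc_castSucc, Fin.snoc_last]
      rw [Fin.sum_univ_eq_sum_range (fun j : ℕ => (p + d / l * j) + d / l * s),
        Finset.sum_add_distrib, Finset.sum_add_distrib, ← Finset.mul_sum]
      have h3 : (∑ i ∈ Finset.range l, (i : ℝ)) * 2 = l * (l - 1) := by
        have := Finset.sum_range_id_mul_two l
        have h4 : ((∑ i ∈ Finset.range l, i : ℕ) : ℝ) * 2 = l * ((l - 1 : ℕ) : ℝ) := by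
          exact_mod_cast this
        rw [Nat.cast_sub (by omega)] at h4
        push_cast at h4
        exact h4
      have h5 : (∑ i ∈ Finset.range l, (i : ℝ)) = l * (l - 1) / 2 := by linarith
      rw [h5]
      simp only [Finset.sum_const, Finset.card_range, nsmul_eq_mul]
      push_cast
      field_simp
      rw [hd]
      ring
  have hcont : ∀ a b : ℝ, Continuous fun s : ℝ => φ (a + b * s) := fun a b => by fun_prop
  have hinteg := intervalIntegral.integral_mono_on (μ := volume) (zero_le_one' ℝ)
    (f := fun _ => C) (by simp) (g := fun s =>
      ∑ j ∈ Finset.range l, φ ((p + d / l * j) + d / l * s) + φ (T + (-d) * s))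
    (Continuous.intervalIntegrable (by fun_prop) _ _) hpt
  rw [intervalIntegral.integral_add (Continuous.intervalIntegrable (by fun_prop) _ _)
    (Continuous.intervalIntegrable (by fun_prop) _ _),
    intervalIntegral.integral_finsetSum
      (fun i _ => Continuous.intervalIntegrable (by fun_prop) _ _)] at hinteg
  simp only [intervalIntegral.integral_const, sub_zero, one_smul] at hinteg
  have e1 : ∀ j : ℕ, d / l * ∫ s in (0 : ℝ)..1, φ ((p + d / l * j) + d / l * s) =
      ∫ x in (p + d / l * j)..(p + d / l * (j + 1 : ℕ)), φ x := by
    intro j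
    rw [intervalIntegral.mul_integral_comp_add_mul]
    push_cast
    congr 1 <;> ring
  have e2 : (-d) * ∫ s in (0 : ℝ)..1, φ (T + (-d) * s) = ∫ x in T..p, φ x := by
    rw [intervalIntegral.mul_integral_comp_add_mul]
    congr 1 <;> simp [hd]
  have e3 : ∑ j ∈ Finset.range l, (d / l * ∫ s in (0 : ℝ)..1, φ ((p + d / l * j) + d / l * s)) =
      ∫ x in p..T, φ x := by
    simp_rw [e1]
    rw [intervalIntegral.sum_integral_adjacent_intervals
      (a := fun j : ℕ => p + d / l * j) (fun _ _ => hφ.intervalIntegrable _ _)]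
    congr 1
    · simp
    · field_simp; rw [hd]; ring
  rw [← Finset.mul_sum] at e3
  rw [intervalIntegral.integral_symm p T] at e2
  set A := ∑ j ∈ Finset.range l, ∫ s in (0 : ℝ)..1, φ ((p + d / l * j) + d / l * s)
  set B := ∫ s in (0 : ℝ)..1, φ (T + (-d) * s)
  have e4 : d * A = l * ∫ x in p..T, φ x := by rw [← e3]; field_simp
  have := mul_le_mul_of_nonneg_right hinteg hd0
  push_cast
  nlinarith

lemma exists_least_argmin {G : ℝ → ℝ} (hG : Continuous G) {a b : ℝ} (hab : a ≤ b) :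
    ∃ l ∈ Set.Icc a b, (∀ x ∈ Set.Icc a b, G l ≤ G x) ∧
      ∀ x ∈ Set.Icc a b, x < l → G l < G x := by
  obtain ⟨m, hm, hmin⟩ := isCompact_Icc.exists_isMinOn (Set.nonempty_Icc.2 hab) hG.continuousOn
  have hc : IsCompact (Set.Icc a b ∩ G ⁻¹' {G m}) :=
    isCompact_Icc.inter_right (isClosed_singleton.preimage hG)
  obtain ⟨l, hl, hleast⟩ := hc.exists_isLeast ⟨m, hm, rfl⟩
  have hlm : G l = G m := hl.2
  refine ⟨l, hl.1, fun x hx => hlm ▸ hmin hx, fun x hx hxl => ?_⟩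
  refine lt_of_le_of_ne (hlm ▸ hmin hx) fun he => ?_
  exact absurd (hleast ⟨hx, by simp [← he, hlm]⟩) (not_le.2 hxl)

lemma integral_two_nonneg {n : ℕ} (hn : 2 ≤ n) {φ : ℝ → ℝ} (hφ : Continuous φ)
    (h : ∀ x : Fin n → ℝ, (∀ i, 0 ≤ x i) → ∑ i, x i = n → 0 ≤ ∑ i, φ (x i)) :
    0 ≤ ∫ x in (0 : ℝ)..2, φ x := by
  have := uniform_average_le hn hφ (p := 0) (T := 2) (C := 0) (by norm_num)
    (fun x hx hs => h x (fun i => (hx i).1) (by rw [hs]; ring))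
  rw [zero_mul] at this
  exact nonneg_of_mul_nonneg_right this (by positivity)

lemma no_double_minimum {n : ℕ} (hn : 2 ≤ n) {φ : ℝ → ℝ} (hφ : Continuous φ)
    (h : ∀ x : Fin n → ℝ, (∀ i, 0 ≤ x i) → ∑ i, x i = n → 0 ≤ ∑ i, φ (x i))
    {x₀ T₀ : ℝ} (hx₀ : x₀ ∈ Set.Icc (0 : ℝ) 2) (hF₀ : ∫ x in (0 : ℝ)..x₀, φ x < 0)
    (hT₀ : T₀ ∈ Set.Icc (2 : ℝ) n)
    (hFT₀ : ∀ x ∈ Set.Icc (0 : ℝ) 2, ∫ x in (0 : ℝ)..T₀, φ x < ∫ x in (0 : ℝ)..x, φ x) :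
    False := by
  have hn' : (2 : ℝ) ≤ n := by exact_mod_cast hn
  set F : ℝ → ℝ := fun y => ∫ x in (0 : ℝ)..y, φ x with hF
  have hFd : ∀ x, HasDerivAt F (φ x) x := fun x =>
    intervalIntegral.integral_hasDerivAt_right (hφ.intervalIntegrable _ _)
      hφ.aestronglyMeasurable.stronglyMeasurableAtFilter hφ.continuousAt
  have hFc : Continuous F := continuous_iff_continuousAt.2 fun x => (hFd x).continuousAt
  have hsub : ∀ a b, ∫ x in a..b, φ x = F b - F a := fun a b =>
    (intervalIntegral.integral_interval_sub_left (hφ.intervalIntegrable _ _)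
      (hφ.intervalIntegrable _ _)).symm
  have hF0 : F 0 = 0 := by simp [hF]
  have hF2 : 0 ≤ F 2 := integral_two_nonneg hn hφ h
  obtain ⟨l, ⟨hl0, hl2⟩, hlmin, hllt⟩ := exists_least_argmin hFc (zero_le_two (α := ℝ))
  obtain ⟨T, ⟨hT2, hTn⟩, hTmin, hTlt⟩ := exists_least_argmin hFc hn'
  have hlneg : F l < 0 := (hlmin _ hx₀).trans_lt hF₀
  have hl0 : 0 < l := lt_of_le_of_ne hl0 (by rintro rfl; linarith)
  have hl2 : l < 2 := lt_of_le_of_ne hl2 (by rintro rfl; linarith)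
  have hTF : ∀ x ∈ Set.Icc (0 : ℝ) 2, F T < F x := fun x hx =>
    (hTmin _ hT₀).trans_lt (hFT₀ x hx)
  have hT2 : 2 < T := lt_of_le_of_ne hT2 (by rintro rfl; exact lt_irrefl _ (hTF 2 (by simp)))
  have hTp : ∀ p, 0 ≤ p → p < T → F T < F p := fun p hp hpT => by
    rcases le_total p 2 with h2 | h2
    · exact hTF p ⟨hp, h2⟩
    · exact hTlt p ⟨h2, by linarith⟩ hpT
  have hφl : φ l = 0 := by
    refine IsLocalMin.hasDerivAt_eq_zero (f := F) ?_ (hFd l)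
    filter_upwards [Icc_mem_nhds hl0 hl2] with x hx using hlmin x hx
  by_cases h1 : 1 < l
  · have := uniform_average_le hn hφ (p := 2 - l) (T := l) (C := 0) (by linarith)
      (fun x hx hs => h x (fun i => by linarith [(hx i).1]) (by rw [hs]; ring))
    rw [hsub, zero_mul] at this
    have h3 := nonneg_of_mul_nonneg_right this (by positivity)
    linarith [hllt (2 - l) ⟨by linarith, by linarith⟩ (by linarith)]
  push Not at h1
  by_cases h2 : n - T < (n - 1) * l
  · obtain ⟨k, rfl⟩ : ∃ k, n = k + 1 := ⟨n - 1, by omega⟩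
    have hk : (1 : ℝ) ≤ k := by exact_mod_cast (by omega : 1 ≤ k)
    push_cast at h2 hTn h hn'
    set p := (k + 1 - T) / k with hp
    set p' := k + 1 - k * l with hp'
    have hkp : k * p = k + 1 - T := by rw [hp]; field_simp
    have hp0 : 0 ≤ p := by apply div_nonneg <;> linarith
    have hpl : p < l := by nlinarith
    have hp'0 : 0 ≤ p' := by nlinarith
    have hp'T : p' < T := by linarith
    have hpt : ∀ t ∈ Set.Icc (0 : ℝ) 1,
        0 ≤ φ (T + (p' - T) * t) + k * φ (p + (l - p) * t) := by
      intro t ht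
      have := h (Fin.cons (T + (p' - T) * t) fun _ => p + (l - p) * t) ?_ ?_
      · simpa [Fin.sum_univ_succ] using this
      · intro i
        refine Fin.cases ?_ (fun j => ?_) i
        · simp only [Fin.cons_zero]
          nlinarith [ht.1, ht.2]
        · simp only [Fin.cons_succ]
          nlinarith [ht.1, ht.2]
      · simp [Fin.sum_univ_succ]
        linear_combination (1 - t) * hkp + t * hp'
    have hinteg := intervalIntegral.integral_nonneg (μ := volume) (zero_le_one (α := ℝ)) hpt
    rw [intervalIntegral.integral_add (Continuous.intervalIntegrable (by fun_prop) _ _)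
      (Continuous.intervalIntegrable (by fun_prop) _ _),
      intervalIntegral.integral_const_mul] at hinteg
    have e1 := intervalIntegral.mul_integral_comp_add_mul (a := 0) (b := 1) (f := φ) (p' - T) T
    have e2 := intervalIntegral.mul_integral_comp_add_mul (a := 0) (b := 1) (f := φ) (l - p) p
    rw [hsub] at e1 e2
    simp only [mul_zero, add_zero, mul_one, add_sub_cancel] at e1 e2
    set I := ∫ x in (0 : ℝ)..1, φ (T + (p' - T) * x)
    set J := ∫ x in (0 : ℝ)..1, φ (p + (l - p) * x)
    have i1 : I < 0 := by
      by_contra hI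
      push Not at hI
      have := hTp p' hp'0 hp'T
      nlinarith
    have i2 : J < 0 := by
      by_contra hJ
      push Not at hJ
      have := hllt p ⟨hp0, by linarith⟩ hpl
      nlinarith
    nlinarith
  push Not at h2
  have hTl : 0 < T - l := by linarith
  set r := n * (1 - l) / (T - l) with hr
  have hrT : r * (T - l) = n * (1 - l) := by rw [hr]; field_simp
  have hr1 : 1 ≤ r := by rw [hr, le_div_iff₀ hTl]; linarith
  have hrn : r < n := by rw [hr, div_lt_iff₀ hTl]; nlinarith
  have hf1 : 1 ≤ ⌊r⌋₊ := Nat.one_le_floor_iff _ |>.2 hr1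
  have hfn : ⌊r⌋₊ < n := (Nat.floor_lt (by linarith)).2 hrn
  obtain ⟨i, hi⟩ : ∃ i, i = ⌊r⌋₊ + 1 := ⟨_, rfl⟩
  have hi2 : 2 ≤ i := by omega
  have hi0 : (0 : ℝ) < i := by exact_mod_cast (by omega : 0 < i)
  have hri : r < i := by rw [hi]; push_cast; exact Nat.lt_floor_add_one r
  have hir : (i : ℝ) ≤ r + 1 := by
    rw [hi]; push_cast; linarith [Nat.floor_le (show 0 ≤ r by linarith)]
  obtain ⟨j, rfl⟩ : ∃ j, n = i + j := ⟨n - i, by omega⟩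
  push_cast at *
  set p := 2 * (i + j - j * l) / i - T with hp
  have hip : i * ((p + T) / 2) = i + j - j * l := by rw [hp]; field_simp; ring
  have hpT : p < T := by nlinarith
  have hp0 : 0 ≤ p := by
    by_contra hneg
    push Not at hneg
    have : i * p < 0 := by nlinarith
    nlinarith
  have := uniform_average_le hi2 hφ (p := p) (T := T) (C := 0) hpT.le (fun x hx hs => by
    have := h (Fin.append x fun _ => l) (fun a => by
      refine Fin.addCases (fun b => ?_) (fun b => ?_) a
      · simpa using hp0.trans (hx b).1
      · simpa using hl0.le) (by
      simp [Fin.sum_univ_add, hs, hip])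
    simpa [Fin.sum_univ_add, hφl] using this)
  rw [hsub, zero_mul] at this
  have h3 := nonneg_of_mul_nonneg_right this hi0
  linarith [hTp p hp0 hpT]

lemma exists_quadratic_le_integral {n : ℕ} (hn : 2 ≤ n) {φ : ℝ → ℝ} (hφ : Continuous φ)
    (h : ∀ x : Fin n → ℝ, (∀ i, 0 ≤ x i) → ∑ i, x i = n → 0 ≤ ∑ i, φ (x i)) :
    ∃ c : ℝ, ∀ R ∈ Set.Icc (0 : ℝ) n, c * (R ^ 2 - 2 * R) ≤ ∫ x in (0 : ℝ)..R, φ x := by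
  set F : ℝ → ℝ := fun y => ∫ x in (0 : ℝ)..y, φ x with hF
  have hF2 : 0 ≤ F 2 := integral_two_nonneg hn hφ h
  set S : Set ℝ := {c | ∀ R ∈ Set.Icc (0 : ℝ) 2, c * (R ^ 2 - 2 * R) ≤ F R} with hS
  have hne : S.Nonempty := by
    obtain ⟨M, hM⟩ := isCompact_Icc.exists_bound_of_continuousOn (s := Set.Icc (0 : ℝ) 2)
      hφ.continuousOn
    have hM0 : 0 ≤ M := (norm_nonneg _).trans (hM 0 (by simp))
    refine ⟨M, fun R hR => ?_⟩
    have b1 : ‖∫ x in (0 : ℝ)..R, φ x‖ ≤ M * |R - 0| :=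
      intervalIntegral.norm_integral_le_of_norm_le_const fun x hx => by
        rw [Set.uIoc_of_le hR.1] at hx
        exact hM x ⟨hx.1.le, hx.2.trans hR.2⟩
    have b2 : ‖∫ x in R..(2 : ℝ), φ x‖ ≤ M * |2 - R| :=
      intervalIntegral.norm_integral_le_of_norm_le_const fun x hx => by
        rw [Set.uIoc_of_le hR.2] at hx
        exact hM x ⟨hR.1.trans hx.1.le, hx.2⟩
    have b3 : F R + ∫ x in R..(2 : ℝ), φ x = F 2 :=
      intervalIntegral.integral_add_adjacent_intervals (hφ.intervalIntegrable _ _)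
        (hφ.intervalIntegrable _ _)
    rw [Real.norm_eq_abs, abs_le, abs_of_nonneg (by linarith [hR.1])] at b1
    rw [Real.norm_eq_abs, abs_le, abs_of_nonneg (by linarith [hR.2])] at b2
    have b1' : -(M * R) ≤ F R := by simpa using b1.1
    rcases le_total R 1 with h1 | h1
    · nlinarith [mul_nonneg (mul_nonneg hM0 hR.1) (sub_nonneg.2 h1)]
    · nlinarith [mul_nonneg (mul_nonneg hM0 (sub_nonneg.2 hR.2)) (sub_nonneg.2 h1)]
  have hbdd : BddBelow S := ⟨-F 1, fun c hc => by
    have := hc 1 (by constructor <;> norm_num)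
    linarith⟩
  have hclosed : IsClosed S := by
    simp only [hS, Set.ofPred_forall]
    exact isClosed_iInter fun R => isClosed_iInter fun _ =>
      isClosed_le (by fun_prop) continuous_const
  have hmem := hclosed.csInf_mem hne hbdd
  set c := sInf S with hc
  refine ⟨c, fun T₀ hT₀ => ?_⟩
  rcases le_total T₀ 2 with h2 | h2
  · exact hmem T₀ ⟨hT₀.1, h2⟩
  by_contra! hlt
  change F T₀ < _ at hlt
  set D := c * (T₀ ^ 2 - 2 * T₀) - F T₀ with hD
  have hD0 : 0 < D := by linarith
  set ε := D / (2 * (T₀ - 1) ^ 2) with hε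
  have hT1 : 0 < (T₀ - 1) ^ 2 := by nlinarith
  have hε0 : 0 < ε := by positivity
  have hεD : ε * (T₀ - 1) ^ 2 < D := by
    have : ε * (T₀ - 1) ^ 2 = D / 2 := by
      rw [hε, div_mul_eq_mul_div, div_eq_div_iff (by positivity) two_ne_zero]; ring
    linarith
  have hnot : c - ε ∉ S := fun hm => by linarith [csInf_le hbdd hm]
  simp only [hS, Set.mem_ofPred_eq, not_forall, not_le] at hnot
  obtain ⟨x₀, hx₀, hlt₀⟩ := hnot
  have hinteg : ∀ R, ∫ x in (0 : ℝ)..R, (φ x - (c - ε) * (2 * x - 2)) =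
      F R - (c - ε) * (R ^ 2 - 2 * R) := by
    intro R
    rw [intervalIntegral.integral_sub (hφ.intervalIntegrable _ _)
      (Continuous.intervalIntegrable (by fun_prop) _ _), intervalIntegral.integral_const_mul,
      intervalIntegral.integral_sub (Continuous.intervalIntegrable (by fun_prop) _ _)
      (Continuous.intervalIntegrable (by fun_prop) _ _), intervalIntegral.integral_const_mul,
      integral_id, intervalIntegral.integral_const, smul_eq_mul]
    ring
  refine no_double_minimum hn (φ := fun x => φ x - (c - ε) * (2 * x - 2)) (by fun_prop) ?_
    hx₀ (T₀ := T₀) ?_ ⟨h2, hT₀.2⟩ ?_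
  · intro x hx hs
    have := h x hx hs
    rw [Finset.sum_sub_distrib, ← Finset.mul_sum, Finset.sum_sub_distrib, ← Finset.mul_sum, hs]
    simp only [Finset.sum_const, Finset.card_univ, Fintype.card_fin, nsmul_eq_mul]
    linarith
  · rw [hinteg]; linarith
  · intro x hx
    rw [hinteg, hinteg]
    have := hmem x hx
    nlinarith [mul_nonneg hε0.le (sq_nonneg (x - 1))]

lemma exists_linear_integral_nonneg {K : ℕ} (hK : 1 ≤ K) {φ : ℝ → ℝ} (hφ : Continuous φ)
    (h : ∀ x : Fin (K + 1) → ℝ, ∑ i, x i = 0 → 0 ≤ ∑ i, φ (x i)) {ρ : ℝ} (hρ : 0 < ρ) :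
    ∃ c : ℝ, ∀ R ∈ Set.Icc (-ρ) (K * ρ), 0 ≤ ∫ u in (-ρ)..R, (φ u - c * u) := by
  obtain ⟨c, hc⟩ := exists_quadratic_le_integral (n := K + 1) (by omega)
    (φ := fun x => φ (-ρ + ρ * x)) (by fun_prop) (fun x _ hs => h _ (by
      rw [Finset.sum_add_distrib, ← Finset.mul_sum, hs]; simp; ring))
  refine ⟨2 * c / ρ, fun R hR => ?_⟩
  have h1 := hc (R / ρ + 1) ⟨by
      have := (le_div_iff₀ hρ (a := -1) (b := R)).2 (by linarith [hR.1]); linarith, by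
      have := (div_le_iff₀ hρ).2 hR.2
      push_cast; linarith⟩
  have h2 := intervalIntegral.mul_integral_comp_add_mul (a := 0) (b := R / ρ + 1) (f := φ) ρ (-ρ)
  have h3 : -ρ + ρ * (R / ρ + 1) = R := by field_simp; ring
  rw [h3, mul_zero, add_zero] at h2
  rw [intervalIntegral.integral_sub (hφ.intervalIntegrable _ _)
      (Continuous.intervalIntegrable (by fun_prop) _ _), intervalIntegral.integral_const_mul,
      integral_id, ← h2]
  have h4 := mul_le_mul_of_nonneg_left h1 hρ.le
  have h5 : ρ * (c * ((R / ρ + 1) ^ 2 - 2 * (R / ρ + 1))) =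
      2 * c / ρ * ((R ^ 2 - (-ρ) ^ 2) / 2) := by field_simp; ring
  linarith

/-- Positive symmetric differentiable functions, decreasing on the positive half-line, with
convex reciprocal square root. -/
structure IsConvexProfile (g : ℝ → ℝ) : Prop where
  pos : ∀ x, 0 < g x
  diff : Differentiable ℝ g
  symm : ∀ x, g (-x) = g x
  dec : ∀ x > (0 : ℝ), deriv g x < 0
  conv : ConvexOn ℝ Set.univ fun x => (Real.sqrt (g x))⁻¹

namespace IsConvexProfile

variable {g : ℝ → ℝ}

lemma antitoneOn (hg : IsConvexProfile g) : AntitoneOn g (Set.Ici 0) :=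
  (strictAntiOn_of_deriv_neg (convex_Ici 0) hg.diff.continuous.continuousOn fun x hx =>
    hg.dec x (by simpa using hx)).antitoneOn

lemma le_of_abs_le (hg : IsConvexProfile g) {x y : ℝ} (h : |y| ≤ |x|) : g x ≤ g y := by
  have habs : ∀ z, g |z| = g z := fun z => by
    rcases abs_choice z with hz | hz <;> rw [hz]
    exact hg.symm z
  rw [← habs x, ← habs y]
  exact hg.antitoneOn (Set.mem_Ici.2 (abs_nonneg _)) (Set.mem_Ici.2 (abs_nonneg _)) h

lemma hasDerivAt_inv_sqrt (hg : IsConvexProfile g) (x : ℝ) :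
    HasDerivAt (fun x => (Real.sqrt (g x))⁻¹)
      (deriv (fun x => (Real.sqrt (g x))⁻¹) x) x :=
  (((hg.diff x).sqrt (hg.pos x).ne').inv (Real.sqrt_ne_zero'.2 (hg.pos x))).hasDerivAt

lemma eq_inv_sq (hg : IsConvexProfile g) (x : ℝ) : g x = ((Real.sqrt (g x))⁻¹ ^ 2)⁻¹ := by
  rw [inv_pow, inv_inv, Real.sq_sqrt (hg.pos x).le]

lemma inv_sqrt_pos (hg : IsConvexProfile g) (x : ℝ) : 0 < (Real.sqrt (g x))⁻¹ :=
  inv_pos.2 (Real.sqrt_pos.2 (hg.pos x))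

lemma deriv_inv_sqrt_mono (hg : IsConvexProfile g) :
    Monotone (deriv fun x => (Real.sqrt (g x))⁻¹) := by
  have := hg.conv.monotoneOn_deriv (fun x _ => (hg.hasDerivAt_inv_sqrt x).differentiableAt)
  exact monotoneOn_univ.1 this

lemma monotoneOn_sub_mul (hg : IsConvexProfile g) {m k : ℝ} (hm : 0 ≤ m) (hk : 1 ≤ k) :
    MonotoneOn (fun x => (Real.sqrt (g (k * x + m)))⁻¹ - k * (Real.sqrt (g (x - m)))⁻¹)
      (Set.Ici 0) := by
  have hd : ∀ x, HasDerivAt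
      (fun x => (Real.sqrt (g (k * x + m)))⁻¹ - k * (Real.sqrt (g (x - m)))⁻¹)
      (deriv (fun x => (Real.sqrt (g x))⁻¹) (k * x + m) * k -
        k * deriv (fun x => (Real.sqrt (g x))⁻¹) (x - m)) x := by
    intro x
    have h1 := (hg.hasDerivAt_inv_sqrt (k * x + m)).comp x
      (((hasDerivAt_id x).const_mul k).add_const m)
    have h2 := ((hg.hasDerivAt_inv_sqrt (x - m)).comp x
      ((hasDerivAt_id x).sub_const m)).const_mul k
    exact (h1.sub h2).congr_deriv (by simp)
  refine monotoneOn_of_deriv_nonneg (convex_Ici 0)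
    (fun x _ => (hd x).continuousAt.continuousWithinAt)
    (fun x _ => (hd x).differentiableAt.differentiableWithinAt) fun x hx => ?_
  rw [interior_Ici] at hx
  have hx0 : 0 < x := hx
  rw [(hd x).deriv]
  have := hg.deriv_inv_sqrt_mono (show x - m ≤ k * x + m by nlinarith)
  nlinarith

end IsConvexProfile

noncomputable def leftMoment (g : ℝ → ℝ) (m a : ℝ) : ℝ := ∫ u in (0 : ℝ)..a, u * g (u - m)

noncomputable def rightMoment (g : ℝ → ℝ) (m y : ℝ) : ℝ := ∫ u in (0 : ℝ)..y, u * g (u + m)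

lemma hasDerivAt_integral_of_continuous {f : ℝ → ℝ} (hf : Continuous f) (a x : ℝ) :
    HasDerivAt (fun y => ∫ u in a..y, f u) (f x) x :=
  intervalIntegral.integral_hasDerivAt_right (hf.intervalIntegrable _ _)
    hf.aestronglyMeasurable.stronglyMeasurableAtFilter hf.continuousAt

namespace IsConvexProfile

variable {g : ℝ → ℝ}

lemma hasDerivAt_leftMoment (hg : IsConvexProfile g) (m x : ℝ) :
    HasDerivAt (leftMoment g m) (x * g (x - m)) x := by
  have := hg.diff.continuous
  exact hasDerivAt_integral_of_continuous (f := fun u => u * g (u - m)) (by fun_prop) 0 x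

lemma hasDerivAt_rightMoment (hg : IsConvexProfile g) (m x : ℝ) :
    HasDerivAt (rightMoment g m) (x * g (x + m)) x := by
  have := hg.diff.continuous
  exact hasDerivAt_integral_of_continuous (f := fun u => u * g (u + m)) (by fun_prop) 0 x

lemma hasDerivAt_moment_sub (hg : IsConvexProfile g) (m k x : ℝ) :
    HasDerivAt (fun x => rightMoment g m (k * x) - leftMoment g m x)
      (x * (k ^ 2 * g (k * x + m) - g (x - m))) x := by
  have h1 := (hg.hasDerivAt_rightMoment m (k * x)).comp x ((hasDerivAt_id x).const_mul k)
  exact (h1.sub (hg.hasDerivAt_leftMoment m x)).congr_deriv (by ring)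

lemma sq_mul_le_iff (hg : IsConvexProfile g) {k : ℝ} (hk : 1 ≤ k) (x y : ℝ) :
    k ^ 2 * g y ≤ g x ↔ k * (Real.sqrt (g x))⁻¹ ≤ (Real.sqrt (g y))⁻¹ := by
  have hx := hg.inv_sqrt_pos x
  have hy := hg.inv_sqrt_pos y
  conv_lhs => rw [hg.eq_inv_sq x, hg.eq_inv_sq y]
  rw [← div_eq_mul_inv, div_le_iff₀ (by positivity), inv_mul_eq_div, le_div_iff₀ (by positivity),
    ← mul_pow, pow_le_pow_iff_left₀ (by positivity) (by positivity) two_ne_zero]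

/-- A proportional pair of matched points can only occur where the reciprocal square root
has grown at least proportionally. -/
lemma mul_inv_sqrt_le_of_matched (hg : IsConvexProfile g) {m k a : ℝ} (hm : 0 ≤ m) (hk : 1 ≤ k)
    (ha : 0 < a) (h : rightMoment g m (k * a) = leftMoment g m a) :
    k * (Real.sqrt (g (a - m)))⁻¹ ≤ (Real.sqrt (g (k * a + m)))⁻¹ := by
  by_contra! hlt
  have hmono : StrictMonoOn (fun x => rightMoment g m (k * x) - leftMoment g m x)
      (Set.Icc 0 a) := by
    refine strictMonoOn_of_deriv_pos (convex_Icc 0 a)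
      (fun x _ => (hg.hasDerivAt_moment_sub m k x).continuousAt.continuousWithinAt)
      fun x hx => ?_
    rw [interior_Icc] at hx
    rw [(hg.hasDerivAt_moment_sub m k x).deriv]
    refine mul_pos hx.1 (sub_pos.2 ?_)
    by_contra! hle
    rw [hg.sq_mul_le_iff hk] at hle
    have := hg.monotoneOn_sub_mul hm hk (Set.mem_Ici.2 hx.1.le) (Set.mem_Ici.2 ha.le) hx.2.le
    simp only at this
    linarith
  have := hmono (Set.left_mem_Icc.2 ha.le) (Set.right_mem_Icc.2 ha.le) ha
  simp only [h, sub_self] at this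
  simp [rightMoment, leftMoment] at this

lemma leftMoment_le_rightMoment_of_frequently (hg : IsConvexProfile g) {m k : ℝ} (hm : 0 ≤ m)
    (hk : 1 ≤ k)
    (h : ∀ ε > 0, ∃ᶠ x in Filter.atTop, -ε < rightMoment g m (k * x) - leftMoment g m x)
    {x : ℝ} (hx : 0 ≤ x) : leftMoment g m x ≤ rightMoment g m (k * x) := by
  by_contra! hlt
  have hx0 : 0 < x := lt_of_le_of_ne hx (by rintro rfl; simp [rightMoment, leftMoment] at hlt)
  set Θ := fun x => rightMoment g m (k * x) - leftMoment g m x with hΘ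
  have hd := hg.hasDerivAt_moment_sub m k
  obtain ⟨ξ, hξ, hξe⟩ := exists_hasDerivAt_eq_slope Θ _ hx0
    (fun x _ => (hd x).continuousAt.continuousWithinAt) (fun x _ => hd x)
  have hΘ0 : Θ 0 = 0 := by simp [hΘ, rightMoment, leftMoment]
  have hΘx : Θ x < 0 := by simp only [hΘ]; linarith
  have hneg : (Θ x - Θ 0) / (x - 0) < 0 := by
    rw [hΘ0]; exact div_neg_of_neg_of_pos (by linarith) (by linarith)
  rw [← hξe] at hneg
  have hξ2 : k ^ 2 * g (k * ξ + m) ≤ g (ξ - m) := by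
    by_contra! hc
    exact absurd hneg (not_lt.2 (mul_nonneg hξ.1.le (by linarith)))
  rw [hg.sq_mul_le_iff hk] at hξ2
  have hanti : AntitoneOn Θ (Set.Ici ξ) := by
    refine antitoneOn_of_deriv_nonpos (convex_Ici ξ)
      (fun x _ => (hd x).continuousAt.continuousWithinAt)
      (fun x _ => (hd x).differentiableAt.differentiableWithinAt) fun y hy => ?_
    rw [interior_Ici] at hy
    have hy' : ξ < y := hy
    have hy0 : 0 < y := hξ.1.trans hy'
    rw [(hd y).deriv]
    refine mul_nonpos_of_nonneg_of_nonpos hy0.le (sub_nonpos.2 ?_)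
    rw [hg.sq_mul_le_iff hk]
    have := hg.monotoneOn_sub_mul hm hk (Set.mem_Ici.2 hξ.1.le) (Set.mem_Ici.2 hy0.le) hy'.le
    simp only at this
    linarith
  obtain ⟨z, hz, hzx⟩ := ((h (-Θ x) (by linarith)).and_eventually
    (Filter.eventually_ge_atTop x)).exists
  have := hanti (Set.mem_Ici.2 hξ.2.le) (Set.mem_Ici.2 (hξ.2.le.trans hzx)) hzx
  simp only [hΘ] at this hz
  linarith

lemma integral_neg_left (hg : IsConvexProfile g) (t : ℝ) :
    ∫ v in (0 : ℝ)..(-t), g v = -∫ v in (0 : ℝ)..t, g v := by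
  have := intervalIntegral.integral_comp_neg (a := 0) (b := t) g
  simp only [hg.symm, neg_zero] at this
  rw [this, intervalIntegral.integral_symm]

lemma integral_id_mul_neg_left (hg : IsConvexProfile g) (t : ℝ) :
    ∫ v in (0 : ℝ)..(-t), v * g v = ∫ v in (0 : ℝ)..t, v * g v := by
  have := intervalIntegral.integral_comp_neg (a := 0) (b := t) fun v => v * g v
  simp only [hg.symm, neg_zero, neg_mul, intervalIntegral.integral_neg] at this
  rw [intervalIntegral.integral_symm, ← this, neg_neg]

lemma leftMoment_eq (hg : IsConvexProfile g) (m x : ℝ) :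
    leftMoment g m x = (∫ v in (0 : ℝ)..(x - m), v * g v) - (∫ v in (0 : ℝ)..m, v * g v) +
      m * ((∫ v in (0 : ℝ)..(x - m), g v) + ∫ v in (0 : ℝ)..m, g v) := by
  have hc := hg.diff.continuous
  have h1 := intervalIntegral.integral_comp_sub_right (a := 0) (b := x)
    (fun v => v * g v + m * g v) m
  have h2 : ∀ a b, IntervalIntegrable (fun v => v * g v) volume a b := fun a b =>
    Continuous.intervalIntegrable (by fun_prop) _ _
  have h3 : ∀ a b, IntervalIntegrable g volume a b := fun a b => hc.intervalIntegrable _ _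
  rw [intervalIntegral.integral_add (h2 _ _) ((h3 _ _).const_mul _),
    intervalIntegral.integral_const_mul, zero_sub,
    ← intervalIntegral.integral_interval_sub_left (h2 0 (x - m)) (h2 0 (-m)),
    ← intervalIntegral.integral_interval_sub_left (h3 0 (x - m)) (h3 0 (-m)),
    hg.integral_neg_left, hg.integral_id_mul_neg_left, sub_neg_eq_add] at h1
  rw [← h1, leftMoment]
  congr 1 with u
  ring

lemma rightMoment_eq (hg : IsConvexProfile g) (m x : ℝ) :
    rightMoment g m x = (∫ v in (0 : ℝ)..(x + m), v * g v) - (∫ v in (0 : ℝ)..m, v * g v) -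
      m * ((∫ v in (0 : ℝ)..(x + m), g v) - ∫ v in (0 : ℝ)..m, g v) := by
  have := hg.leftMoment_eq (-m) x
  rw [hg.integral_neg_left, hg.integral_id_mul_neg_left] at this
  simp only [sub_neg_eq_add, leftMoment] at this
  rw [rightMoment, this]
  ring

lemma integral_le_half (hg : IsConvexProfile g) (hinteg : Integrable g) (h1 : ∫ x, g x = 1)
    {t : ℝ} (ht : 0 ≤ t) : ∫ v in (0 : ℝ)..t, g v ≤ 1 / 2 := by
  have hc := hg.diff.continuous
  have e := intervalIntegral.integral_add_adjacent_intervals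
    (hc.intervalIntegrable (μ := volume) (-t) 0)
    (hc.intervalIntegrable 0 t)
  rw [intervalIntegral.integral_symm, hg.integral_neg_left, neg_neg,
    intervalIntegral.integral_of_le (a := -t) (by linarith)] at e
  have := setIntegral_le_integral (s := Set.Ioc (-t) t) hinteg
    (Filter.Eventually.of_forall fun x => (hg.pos x).le)
  linarith

lemma tendsto_id_mul (hg : IsConvexProfile g) (hinteg : Integrable g) :
    Filter.Tendsto (fun v => v * g v) Filter.atTop (nhds 0) := by
  have hc := hg.diff.continuous
  have hA := intervalIntegral_tendsto_integral_Ioi 0 hinteg.integrableOn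
    (Filter.tendsto_id (α := ℝ) (x := Filter.atTop))
  have hhalf : Filter.Tendsto (fun v : ℝ => v / 2) Filter.atTop Filter.atTop :=
    Filter.tendsto_id.atTop_div_const two_pos
  have hlim := (hA.sub (hA.comp hhalf)).const_mul 2
  rw [sub_self, mul_zero] at hlim
  refine tendsto_of_tendsto_of_tendsto_of_le_of_le' tendsto_const_nhds hlim ?_ ?_
  · filter_upwards [Filter.eventually_ge_atTop 0] with v hv using mul_nonneg hv (hg.pos v).le
  · filter_upwards [Filter.eventually_ge_atTop 0] with v hv
    simp only [id, Function.comp_apply]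
    rw [intervalIntegral.integral_interval_sub_left (hc.intervalIntegrable _ _)
      (hc.intervalIntegrable _ _)]
    have := intervalIntegral.integral_mono_on (μ := volume) (a := v / 2) (b := v)
      (f := fun _ => g v) (g := g) (by linarith) (by simp) (hc.intervalIntegrable _ _)
      (fun x hx => hg.antitoneOn (Set.mem_Ici.2 (by linarith [hx.1])) (Set.mem_Ici.2 hv) hx.2)
    rw [intervalIntegral.integral_const, smul_eq_mul] at this
    linarith

lemma eventually_lt_moment_sub (hg : IsConvexProfile g) (hinteg : Integrable g)
    (h1 : ∫ x, g x = 1) {m k : ℝ} (hm : 0 ≤ m) (hk : 1 ≤ k)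
    (hlim : m ≤ Filter.liminf (fun t : ℝ => ∫ x in t..(k * t), x * g x) Filter.atTop)
    {ε : ℝ} (hε : 0 < ε) :
    ∀ᶠ x in Filter.atTop, -ε < rightMoment g m (k * x) - leftMoment g m x := by
  have hc := hg.diff.continuous
  have hii : ∀ a b, IntervalIntegrable (fun v => v * g v) volume a b := fun a b =>
    Continuous.intervalIntegrable (by fun_prop) _ _
  have hpos : ∀ a b : ℝ, 0 ≤ a → a ≤ b → 0 ≤ ∫ x in a..b, x * g x := fun a b ha hab =>
    intervalIntegral.integral_nonneg hab fun x hx => mul_nonneg (ha.trans hx.1) (hg.pos x).le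
  have hb : Filter.IsBoundedUnder (· ≥ ·) Filter.atTop
      (fun t : ℝ => ∫ x in t..(k * t), x * g x) :=
    Filter.isBoundedUnder_of_eventually_ge (a := 0) (by
      filter_upwards [Filter.eventually_ge_atTop 0] with t ht
      exact hpos t (k * t) ht (by nlinarith))
  have hev := Filter.eventually_lt_of_lt_liminf (b := m - ε / 2) (by linarith) hb
  have hδ : 0 < ε / (2 * (k * m + 1)) := by positivity
  have hsmall := (hg.tendsto_id_mul hinteg).eventually (gt_mem_nhds hδ)
  obtain ⟨X, hX⟩ := Filter.eventually_atTop.1 hsmall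
  have hev' := (Filter.tendsto_atTop_add_const_right Filter.atTop m
    Filter.tendsto_id).eventually hev
  filter_upwards [hev', Filter.eventually_ge_atTop X, Filter.eventually_ge_atTop m]
    with x hx hxX hxm
  simp only [id] at hx
  rw [hg.leftMoment_eq, hg.rightMoment_eq]
  have hx0 : 0 ≤ x := hm.trans hxm
  have a1 := hg.integral_le_half hinteg h1 (t := k * x + m) (by positivity)
  have a2 := hg.integral_le_half hinteg h1 (t := x - m) (by linarith)
  have p1 := hpos (x - m) (x + m) (by linarith) (by linarith)
  have hle : k * x + m ≤ k * (x + m) := by nlinarith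
  have p2 := intervalIntegral.integral_mono_on (μ := volume) (f := fun v => v * g v)
    (g := fun _ => ε / (2 * (k * m + 1))) hle (hii _ _) (by simp)
    (fun v hv => (hX v (by nlinarith [hv.1])).le)
  rw [intervalIntegral.integral_const, smul_eq_mul] at p2
  have p3 : (k * (x + m) - (k * x + m)) * (ε / (2 * (k * m + 1))) ≤ ε / 2 := by
    rw [mul_div_assoc', div_le_div_iff₀ (by positivity) two_pos]
    nlinarith
  rw [← intervalIntegral.integral_interval_sub_left (hii 0 _) (hii 0 _)] at p1 p2 hx
  nlinarith

lemma leftMoment_le_rightMoment_mul (hg : IsConvexProfile g) (hinteg : Integrable g)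
    (h1 : ∫ x, g x = 1) {m k : ℝ} (hm : 0 ≤ m) (hk : 1 ≤ k)
    (hlim : m ≤ Filter.liminf (fun t : ℝ => ∫ x in t..(k * t), x * g x) Filter.atTop)
    {x : ℝ} (hx : 0 ≤ x) : leftMoment g m x ≤ rightMoment g m (k * x) :=
  hg.leftMoment_le_rightMoment_of_frequently hm hk (fun _ hε =>
    (hg.eventually_lt_moment_sub hinteg h1 hm hk hlim hε).frequently) hx

lemma rightMoment_le_leftMoment (hg : IsConvexProfile g) {m x : ℝ} (hm : 0 ≤ m) (hx : 0 ≤ x) :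
    rightMoment g m x ≤ leftMoment g m x := by
  have hc := hg.diff.continuous
  refine intervalIntegral.integral_mono_on hx
    (Continuous.intervalIntegrable (by fun_prop) _ _)
    (Continuous.intervalIntegrable (by fun_prop) _ _) fun u hu => ?_
  refine mul_le_mul_of_nonneg_left (hg.le_of_abs_le ?_) hu.1
  rw [abs_le, abs_of_nonneg (by linarith [hu.1])]
  constructor <;> linarith [hu.1]

end IsConvexProfile

/-- Two increasing functions vanishing at the origin, one dominating the other, are matched by
a differentiable change of variables. -/
lemma exists_matching {L R L' R' : ℝ → ℝ} (hL : ∀ x, HasDerivAt L (L' x) x)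
    (hR : ∀ x, HasDerivAt R (R' x) x) (hL'c : Continuous L')
    (hL' : ∀ x > 0, 0 < L' x) (hR' : ∀ x > 0, 0 < R' x) (hL0 : L 0 = 0) (hR0 : R 0 = 0)
    (hRL : ∀ x, 0 ≤ x → R x ≤ L x) :
    ∃ α : ℝ → ℝ, (∀ y, 0 ≤ y → 0 ≤ α y ∧ α y ≤ y ∧ L (α y) = R y) ∧
      ContinuousOn α (Set.Ici 0) ∧
      ∀ y > 0, 0 < α y ∧ HasDerivAt α (R' y / L' (α y)) y := by
  have hLm : StrictMonoOn L (Set.Ici 0) := strictMonoOn_of_deriv_pos (convex_Ici 0)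
    (fun x _ => (hL x).continuousAt.continuousWithinAt) fun x hx => by
      rw [(hL x).deriv]; exact hL' x (by simpa using hx)
  have hRm : StrictMonoOn R (Set.Ici 0) := strictMonoOn_of_deriv_pos (convex_Ici 0)
    (fun x _ => (hR x).continuousAt.continuousWithinAt) fun x hx => by
      rw [(hR x).deriv]; exact hR' x (by simpa using hx)
  have hLc : Continuous L := continuous_iff_continuousAt.2 fun x => (hL x).continuousAt
  have hRc : Continuous R := continuous_iff_continuousAt.2 fun x => (hR x).continuousAt
  have hex : ∀ y : ℝ, ∃ a, 0 ≤ y → 0 ≤ a ∧ a ≤ y ∧ L a = R y := by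
    intro y
    by_cases hy : 0 ≤ y
    · have h0 : L 0 ≤ R y := by
        rw [hL0, ← hR0]
        exact hRm.monotoneOn (Set.mem_Ici.2 le_rfl) (Set.mem_Ici.2 hy) hy
      obtain ⟨a, ha, hae⟩ := intermediate_value_Icc hy hLc.continuousOn ⟨h0, hRL y hy⟩
      exact ⟨a, fun _ => ⟨ha.1, ha.2, hae⟩⟩
    · exact ⟨0, fun h => absurd h hy⟩
  choose α hα using hex
  have hpos : ∀ y > 0, 0 < α y := by
    intro y hy
    refine lt_of_le_of_ne (hα y hy.le).1 fun h => ?_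
    have h2 := (hα y hy.le).2.2
    rw [← h, hL0, ← hR0] at h2
    exact absurd h2 (hRm (Set.mem_Ici.2 le_rfl) (Set.mem_Ici.2 hy.le) hy).ne
  have hmono : StrictMonoOn α (Set.Ioi 0) := by
    intro x hx y hy hxy
    have hx0 : 0 ≤ x := le_of_lt hx
    have hy0 : 0 ≤ y := le_of_lt hy
    rw [← hLm.lt_iff_lt (Set.mem_Ici.2 (hα x hx0).1) (Set.mem_Ici.2 (hα y hy0).1),
      (hα x hx0).2.2, (hα y hy0).2.2]
    exact hRm (Set.mem_Ici.2 hx0) (Set.mem_Ici.2 hy0) hxy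
  have hcont : ∀ y > 0, ContinuousAt α y := by
    intro y hy
    refine hmono.continuousAt_of_image_mem_nhds (Ioi_mem_nhds hy) ?_
    have hlt : α y < α (y + 1) := hmono hy (Set.mem_Ioi.2 (by linarith)) (by linarith)
    filter_upwards [Ioo_mem_nhds (hpos y hy) hlt] with a ha
    have hy1 : 0 ≤ y + 1 := by linarith
    have h1 : R 0 < L a := by
      rw [hR0, ← hL0]
      exact hLm (Set.mem_Ici.2 le_rfl) (Set.mem_Ici.2 ha.1.le) ha.1
    have h2 : L a ≤ R (y + 1) := by
      rw [← (hα (y + 1) hy1).2.2]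
      exact hLm.monotoneOn (Set.mem_Ici.2 ha.1.le) (Set.mem_Ici.2 (hα _ hy1).1) ha.2.le
    obtain ⟨z, hz, hze⟩ := intermediate_value_Icc hy1 hRc.continuousOn ⟨h1.le, h2⟩
    have hz0 : 0 < z := lt_of_le_of_ne hz.1 (by rintro rfl; linarith)
    refine ⟨z, hz0, hLm.injOn (Set.mem_Ici.2 (hα z hz.1).1) (Set.mem_Ici.2 ha.1.le) ?_⟩
    rw [(hα z hz.1).2.2, hze]
  refine ⟨α, fun y hy => hα y hy, ?_, fun y hy => ⟨hpos y hy, ?_⟩⟩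
  · intro y hy
    rcases (Set.mem_Ici.1 hy).eq_or_lt with rfl | hy
    · have h0 : α 0 = 0 := le_antisymm (hα 0 le_rfl).2.1 (hα 0 le_rfl).1
      rw [ContinuousWithinAt, h0]
      refine tendsto_of_tendsto_of_tendsto_of_le_of_le' tendsto_const_nhds
        (Filter.tendsto_id.mono_left nhdsWithin_le_nhds) ?_ ?_
      · filter_upwards [self_mem_nhdsWithin] with z hz using (hα z hz).1
      · filter_upwards [self_mem_nhdsWithin] with z hz using (hα z hz).2.1
    · exact (hcont y hy).continuousWithinAt
  · have hs : HasStrictDerivAt L (L' (α y)) (α y) :=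
      hasStrictDerivAt_of_hasDerivAt_of_continuousAt
        (Filter.Eventually.of_forall hL) hL'c.continuousAt
    have hne := (hL' _ (hpos y hy)).ne'
    have hinv := (hs.to_localInverse hne).hasDerivAt
    rw [(hα y hy.le).2.2] at hinv
    have hcomp := hinv.comp y (hR y)
    rw [div_eq_inv_mul]
    refine hcomp.congr_of_eventuallyEq ?_
    filter_upwards [(hcont y hy).eventually
        (hs.hasStrictFDerivAt_equiv hne).eventually_left_inverse,
      Ioi_mem_nhds hy] with z hz hz0
    rw [Function.comp_apply, ← (hα z (le_of_lt hz0)).2.2]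
    exact hz.symm

lemma sub_mul_le_sub_mul_of_antitone {V S w s w' : ℝ → ℝ} {a b : ℝ} (hab : a ≤ b)
    (hV : ContinuousOn V (Set.Icc a b)) (hS : ContinuousOn S (Set.Icc a b))
    (hw : ContinuousOn w (Set.Icc a b))
    (hVd : ∀ x ∈ Set.Ioo a b, HasDerivAt V (w x * s x) x)
    (hSd : ∀ x ∈ Set.Ioo a b, HasDerivAt S (s x) x)
    (hwd : ∀ x ∈ Set.Ioo a b, HasDerivAt w (w' x) x)
    (hw' : ∀ x ∈ Set.Ioo a b, w' x ≤ 0) (hS0 : ∀ x ∈ Set.Ioo a b, 0 ≤ S x) :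
    V a - w a * S a ≤ V b - w b * S b := by
  have hd : ∀ x ∈ Set.Ioo a b, HasDerivAt (fun x => V x - w x * S x) (-(w' x * S x)) x := by
    intro x hx
    exact ((hVd x hx).sub ((hwd x hx).mul (hSd x hx))).congr_deriv (by ring)
  have hm : MonotoneOn (fun x => V x - w x * S x) (Set.Icc a b) := by
    refine monotoneOn_of_deriv_nonneg (convex_Icc a b) (hV.sub (hw.mul hS)) ?_ ?_
    · intro x hx
      rw [interior_Icc] at hx
      exact (hd x hx).differentiableAt.differentiableWithinAt
    · intro x hx
      rw [interior_Icc] at hx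
      rw [(hd x hx).deriv]
      have := mul_nonneg (neg_nonneg.2 (hw' x hx)) (hS0 x hx)
      linarith
  exact hm (Set.left_mem_Icc.2 hab) (Set.right_mem_Icc.2 hab) hab

/-- `α` sends a right endpoint `y` to the left endpoint `-α y` with equal first moment. -/
structure IsMatching (g : ℝ → ℝ) (m k : ℝ) (α : ℝ → ℝ) : Prop where
  cont : Continuous α
  monotoneOn : MonotoneOn α (Set.Ici 0)
  nonneg : ∀ y, 0 ≤ y → 0 ≤ α y
  le_self : ∀ y, 0 ≤ y → α y ≤ y
  le_mul : ∀ y, 0 ≤ y → y ≤ k * α y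
  moment : ∀ y, 0 ≤ y → leftMoment g m (α y) = rightMoment g m y
  pos : ∀ y > 0, 0 < α y
  hasDerivAt : ∀ y > 0, HasDerivAt α (y * g (y + m) / (α y * g (α y - m))) y

namespace IsConvexProfile

variable {g : ℝ → ℝ}

lemma strictMonoOn_leftMoment (hg : IsConvexProfile g) (m : ℝ) :
    StrictMonoOn (leftMoment g m) (Set.Ici 0) := strictMonoOn_of_deriv_pos (convex_Ici 0)
  (fun x _ => (hg.hasDerivAt_leftMoment m x).continuousAt.continuousWithinAt) fun x hx => by
    rw [(hg.hasDerivAt_leftMoment m x).deriv]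
    exact mul_pos (by simpa using hx) (hg.pos _)

lemma strictMonoOn_rightMoment (hg : IsConvexProfile g) (m : ℝ) :
    StrictMonoOn (rightMoment g m) (Set.Ici 0) := strictMonoOn_of_deriv_pos (convex_Ici 0)
  (fun x _ => (hg.hasDerivAt_rightMoment m x).continuousAt.continuousWithinAt) fun x hx => by
    rw [(hg.hasDerivAt_rightMoment m x).deriv]
    exact mul_pos (by simpa using hx) (hg.pos _)

lemma exists_isMatching (hg : IsConvexProfile g) {m k : ℝ} (hm : 0 ≤ m) (hk : 1 ≤ k)
    (hle : ∀ x, 0 ≤ x → leftMoment g m x ≤ rightMoment g m (k * x)) :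
    ∃ α, IsMatching g m k α := by
  have hc := hg.diff.continuous
  obtain ⟨α, hα, hαc, hαd⟩ := exists_matching (hg.hasDerivAt_leftMoment m)
    (hg.hasDerivAt_rightMoment m) (by fun_prop) (fun x hx => mul_pos hx (hg.pos _))
    (fun x hx => mul_pos hx (hg.pos _)) (by simp [leftMoment]) (by simp [rightMoment])
    (fun x hx => hg.rightMoment_le_leftMoment hm hx)
  have hmax : ∀ y, 0 ≤ y → α (max y 0) = α y := fun y hy => by rw [max_eq_left hy]
  refine ⟨fun y => α (max y 0), ⟨?_, ?_, ?_, ?_, ?_, ?_, ?_, ?_⟩⟩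
  · exact hαc.comp_continuous (by fun_prop) fun y => Set.mem_Ici.2 (le_max_right _ _)
  · intro x hx y hy hxy
    simp only [hmax x hx, hmax y hy]
    rw [← (hg.strictMonoOn_leftMoment m).le_iff_le (hα x hx).1 (hα y hy).1, (hα x hx).2.2,
      (hα y hy).2.2]
    exact (hg.strictMonoOn_rightMoment m).monotoneOn hx hy hxy
  · intro y hy; simpa only [hmax y hy] using (hα y hy).1
  · intro y hy; simpa only [hmax y hy] using (hα y hy).2.1
  · intro y hy
    simp only [hmax y hy]
    have h0 := (hα y hy).1
    rw [← (hg.strictMonoOn_rightMoment m).le_iff_le (Set.mem_Ici.2 hy)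
      (Set.mem_Ici.2 (by positivity)), ← (hα y hy).2.2]
    exact hle _ h0
  · intro y hy; simpa only [hmax y hy] using (hα y hy).2.2
  · intro y hy; simpa only [hmax y hy.le] using (hαd y hy).1
  · intro y hy
    simp only [hmax y hy.le]
    refine (hαd y hy).2.congr_of_eventuallyEq ?_
    filter_upwards [Ioi_mem_nhds hy] with z hz using hmax z (le_of_lt hz)

lemma deriv_inv_sqrt_nonneg (hg : IsConvexProfile g) {x : ℝ} (hx : 0 ≤ x) :
    0 ≤ deriv (fun x => (Real.sqrt (g x))⁻¹) x := by
  have h0 : deriv (fun x => (Real.sqrt (g x))⁻¹) 0 = 0 := by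
    refine IsLocalMin.deriv_eq_zero (Filter.Eventually.of_forall fun y => ?_)
    exact inv_anti₀ (Real.sqrt_pos.2 (hg.pos _))
      (Real.sqrt_le_sqrt (hg.le_of_abs_le (by simp)))
  rw [← h0]
  exact hg.deriv_inv_sqrt_mono hx

lemma deriv_nonpos (hg : IsConvexProfile g) {x : ℝ} (hx : 0 ≤ x) : deriv g x ≤ 0 := by
  rcases hx.eq_or_lt with rfl | hx
  · exact (IsLocalMax.deriv_eq_zero (Filter.Eventually.of_forall fun y =>
      hg.le_of_abs_le (by simp))).le
  · exact (hg.dec x hx).le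

end IsConvexProfile

namespace IsMatching

variable {g α : ℝ → ℝ} {m k : ℝ}

lemma hasDerivAt_ratio (hα : IsMatching g m k α) (hg : IsConvexProfile g) (hm : 0 ≤ m)
    {y : ℝ} (hy : 0 < y) (hmy : m ≤ α y) :
    ∃ d ≤ 0, HasDerivAt (fun u => g (u + m) / g (α u - m)) d y := by
  set h := fun x => (Real.sqrt (g x))⁻¹ with hh
  have hhpos : ∀ x, 0 < h x := hg.inv_sqrt_pos
  have hgh : ∀ x, g x = (h x ^ 2)⁻¹ := hg.eq_inv_sq
  have ha := hα.pos y hy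
  have e : (fun u => g (u + m) / g (α u - m)) = fun u => (h (α u - m) / h (u + m)) ^ 2 := by
    ext u
    rw [hgh (u + m), hgh (α u - m), div_pow]
    simp only [div_eq_mul_inv, inv_inv]
    ring
  have d1 : HasDerivAt (fun u => h (α u - m)) (deriv h (α y - m) *
      (y * g (y + m) / (α y * g (α y - m)))) y :=
    HasDerivAt.comp (h₂ := h) y (hg.hasDerivAt_inv_sqrt (α y - m))
      ((hα.hasDerivAt y hy).sub_const m)
  have d2 : HasDerivAt (fun u => h (u + m)) (deriv h (y + m) * 1) y :=
    HasDerivAt.comp (h₂ := h) y (hg.hasDerivAt_inv_sqrt (y + m)) ((hasDerivAt_id y).add_const m)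
  have d3 := (d1.div d2 (hhpos _).ne').pow 2
  rw [e]
  refine ⟨_, ?_, d3⟩
  have hratio : y / α y * h (α y - m) ≤ h (y + m) := by
    have := hg.mul_inv_sqrt_le_of_matched hm (k := y / α y) (a := α y)
      ((one_le_div ha).2 (hα.le_self y hy.le)) ha
      (by rw [div_mul_cancel₀ _ ha.ne']; exact (hα.moment y hy.le).symm)
    rwa [div_mul_cancel₀ _ ha.ne'] at this
  have hL := hg.deriv_inv_sqrt_nonneg (sub_nonneg.2 hmy)
  have hLR := hg.deriv_inv_sqrt_mono
    (show α y - m ≤ y + m by linarith [hα.le_self y hy.le])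
  have p1 := hhpos (α y - m)
  have p2 := hhpos (y + m)
  have hnum : deriv h (α y - m) * (y * g (y + m) / (α y * g (α y - m))) * h (y + m) -
      h (α y - m) * (deriv h (y + m) * 1) ≤ 0 := by
    have e2 : deriv h (α y - m) * (y * g (y + m) / (α y * g (α y - m))) * h (y + m) =
        deriv h (α y - m) * h (α y - m) * (y / α y * h (α y - m) / h (y + m)) := by
      rw [hgh (y + m), hgh (α y - m)]
      field_simp
    have e3 : y / α y * h (α y - m) / h (y + m) ≤ 1 := (div_le_one p2).2 hratio
    rw [e2]
    have := mul_le_mul_of_nonneg_left e3 (mul_nonneg hL p1.le)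
    have := mul_le_mul_of_nonneg_left hLR p1.le
    change h (α y - m) * deriv h (α y - m) ≤ h (α y - m) * deriv h (y + m) at this
    linarith
  refine mul_nonpos_of_nonneg_of_nonpos ?_ (div_nonpos_of_nonpos_of_nonneg hnum (by positivity))
  have : 0 < h (α y - m) / h (y + m) := div_pos p1 p2
  simp only [Nat.cast_ofNat, Nat.add_one_sub_one, pow_one, Pi.div_apply]
  positivity

end IsMatching

/-- The integral of `φ` against Lebesgue measure on `[-α y, -m]` and the density
`g (u + m) / g (α (max u y₀) - m)` on `[-m, y]`, where `α y₀ = m`. -/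
noncomputable def matchedIntegral (g α : ℝ → ℝ) (m y₀ : ℝ) (φ : ℝ → ℝ) (y : ℝ) : ℝ :=
  (∫ u in (-α y)..(-m), φ u) + (∫ u in (-m)..y₀, g (u + m) / g 0 * φ u) +
    ∫ u in y₀..y, g (u + m) / g (α u - m) * φ u

namespace IsMatching

variable {g α : ℝ → ℝ} {m k y₀ : ℝ}

lemma exists_apply_eq (hα : IsMatching g m k α) (hm : 0 ≤ m) (hk : 1 ≤ k) :
    ∃ y₀, 0 ≤ y₀ ∧ α y₀ = m := by
  have h0 : α 0 ≤ m := (hα.le_self 0 le_rfl).trans hm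
  have hkm : 0 ≤ k * m := by positivity
  have h1 : m ≤ α (k * m) := by
    have := hα.le_mul (k * m) hkm
    exact le_of_mul_le_mul_left this (by linarith)
  obtain ⟨y, hy, hye⟩ := intermediate_value_Icc hkm hα.cont.continuousOn ⟨h0, h1⟩
  exact ⟨y, hy.1, hye⟩

lemma continuous_ratio (hα : IsMatching g m k α) (hg : IsConvexProfile g) :
    Continuous fun u => g (u + m) / g (α u - m) := by
  have hc := hg.diff.continuous
  have := hα.cont
  exact Continuous.div (by fun_prop) (by fun_prop) fun u => (hg.pos _).ne'

lemma hasDerivAt_matchedIntegral (hα : IsMatching g m k α) (hg : IsConvexProfile g)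
    {φ : ℝ → ℝ} (hφ : Continuous φ) {y : ℝ} (hy : 0 < y) :
    HasDerivAt (matchedIntegral g α m y₀ φ)
      (y * g (y + m) / (α y * g (α y - m)) * φ (-α y) + g (y + m) / g (α y - m) * φ y) y := by
  have h1 := HasDerivAt.comp (h₂ := fun z => ∫ u in (-m)..z, φ u) y
    (hasDerivAt_integral_of_continuous hφ (-m) (-α y)) (hα.hasDerivAt y hy).neg
  have h2 := hasDerivAt_integral_of_continuous ((hα.continuous_ratio hg).mul hφ) y₀ y
  refine HasDerivAt.congr_of_eventuallyEq (((h1.neg.add_const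
    (∫ u in (-m)..y₀, g (u + m) / g 0 * φ u)).add h2).congr_deriv (by simp; ring))
    (Filter.Eventually.of_forall fun z => ?_)
  simp only [matchedIntegral, Pi.add_apply, Pi.neg_apply, Function.comp_apply]
  rw [intervalIntegral.integral_symm]
  rfl

lemma continuous_matchedIntegral (hα : IsMatching g m k α) (hg : IsConvexProfile g)
    {φ : ℝ → ℝ} (hφ : Continuous φ) : Continuous (matchedIntegral g α m y₀ φ) := by
  have h1 : Continuous fun z => ∫ u in (-m)..z, φ u :=
    continuous_iff_continuousAt.2 fun z => (hasDerivAt_integral_of_continuous hφ _ z).continuousAt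
  have h2 : Continuous fun z => ∫ u in y₀..z, g (u + m) / g (α u - m) * φ u :=
    continuous_iff_continuousAt.2 fun z =>
      (hasDerivAt_integral_of_continuous ((hα.continuous_ratio hg).mul hφ) _ z).continuousAt
  have h3 : Continuous fun z => ∫ u in (-α z)..(-m), φ u := by
    simp_rw [intervalIntegral.integral_symm (-m)]
    exact (h1.comp hα.cont.neg).neg
  exact (h3.add continuous_const).add h2

lemma matchedIntegral_sub (hα : IsMatching g m k α) (hg : IsConvexProfile g)
    {φ ψ : ℝ → ℝ} (hφ : Continuous φ) (hψ : Continuous ψ) (c y : ℝ) :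
    matchedIntegral g α m y₀ (fun u => φ u - c * ψ u) y =
      matchedIntegral g α m y₀ φ y - c * matchedIntegral g α m y₀ ψ y := by
  have hr := hα.continuous_ratio hg
  have hc := hg.diff.continuous
  have hr0 : ∀ {f : ℝ → ℝ}, Continuous f → Continuous fun u => g (u + m) / g 0 * f u :=
    fun hf => by fun_prop
  have hr1 : ∀ {f : ℝ → ℝ}, Continuous f → Continuous fun u => g (u + m) / g (α u - m) * f u :=
    fun hf => hr.mul hf
  simp only [matchedIntegral, mul_sub, mul_left_comm _ c]
  rw [intervalIntegral.integral_sub (hφ.intervalIntegrable _ _)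
      ((hψ.intervalIntegrable _ _).const_mul _),
    intervalIntegral.integral_sub ((hr0 hφ).intervalIntegrable _ _)
      (((hr0 hψ).intervalIntegrable _ _).const_mul _),
    intervalIntegral.integral_sub ((hr1 hφ).intervalIntegrable _ _)
      (((hr1 hψ).intervalIntegrable _ _).const_mul _),
    intervalIntegral.integral_const_mul, intervalIntegral.integral_const_mul,
    intervalIntegral.integral_const_mul]
  ring

lemma integral_id_mul_neg_eq_leftMoment (hg : IsConvexProfile g) (a : ℝ) :
    ∫ u in (0 : ℝ)..(-a), u * g (u + m) = leftMoment g m a := by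
  have := intervalIntegral.integral_comp_neg (a := 0) (b := a) fun u => u * g (u + m)
  rw [neg_zero] at this
  rw [intervalIntegral.integral_symm, ← this, leftMoment, ← intervalIntegral.integral_neg]
  congr 1 with u
  rw [← hg.symm (u - m)]
  ring_nf

lemma matchedIntegral_id (hα : IsMatching g m k α) (hg : IsConvexProfile g) (hy₀ : 0 ≤ y₀)
    (hαy₀ : α y₀ = m) {y : ℝ} (hy : y₀ ≤ y) :
    matchedIntegral g α m y₀ (fun u => u) y = 0 := by
  have hc := hg.diff.continuous
  have hy₀0 : matchedIntegral g α m y₀ (fun u => u) y₀ = 0 := by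
    have hii : ∀ a b, IntervalIntegrable (fun u => u * g (u + m)) volume a b := fun a b =>
      Continuous.intervalIntegrable (by fun_prop) _ _
    have : ∫ u in (-m)..y₀, u * g (u + m) = 0 := by
      have hmom := hα.moment y₀ hy₀
      rw [hαy₀, rightMoment] at hmom
      rw [← intervalIntegral.integral_interval_sub_left (hii 0 _) (hii 0 _),
        integral_id_mul_neg_eq_leftMoment hg, hmom, sub_self]
    have e : ∀ u, g (u + m) / g 0 * u = (g 0)⁻¹ * (u * g (u + m)) := fun u => by ring
    simp only [matchedIntegral, hαy₀, intervalIntegral.integral_same, e,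
      intervalIntegral.integral_const_mul, this]
    simp
  rcases hy.eq_or_lt with rfl | hlt
  · exact hy₀0
  obtain ⟨ξ, hξ, hξe⟩ := exists_hasDerivAt_eq_slope (matchedIntegral g α m y₀ fun u => u) _ hlt
    (hα.continuous_matchedIntegral hg continuous_id).continuousOn
    (fun x hx => hα.hasDerivAt_matchedIntegral hg continuous_id (hy₀.trans_lt hx.1))
  have hξ0 := hα.pos ξ (hy₀.trans_lt hξ.1)
  rw [hy₀0, sub_zero, _root_.eq_div_iff (by linarith)] at hξe
  rw [← hξe]
  have := hg.pos (α ξ - m)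
  simp only [id]
  field_simp
  ring

lemma matchedIntegral_nonneg_of_integral_nonneg (hα : IsMatching g m k α)
    (hg : IsConvexProfile g) (hm : 0 ≤ m) (hy₀ : 0 ≤ y₀) (hαy₀ : α y₀ = m) {ψ : ℝ → ℝ}
    (hψ : Continuous ψ) {y : ℝ} (hy : y₀ ≤ y)
    (h : ∀ R ∈ Set.Icc (-α y) (k * α y), 0 ≤ ∫ u in (-α y)..R, ψ u) :
    0 ≤ matchedIntegral g α m y₀ ψ y := by
  have hc := hg.diff.continuous
  have hmy : m ≤ α y := hαy₀ ▸ hα.monotoneOn hy₀ (hy₀.trans hy) hy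
  have hyk := hα.le_mul y (hy₀.trans hy)
  set S := fun R => ∫ u in (-α y)..R, ψ u with hS
  have hSd : ∀ x, HasDerivAt S (ψ x) x := hasDerivAt_integral_of_continuous hψ _
  have hSc : Continuous S := continuous_iff_continuousAt.2 fun x => (hSd x).continuousAt
  have hS0 : ∀ R, -m ≤ R → R ≤ y → 0 ≤ S R := fun R h1 h2 =>
    h R ⟨by linarith, h2.trans hyk⟩
  have hr0 : Continuous fun u => g (u + m) / g 0 := by fun_prop
  have hr := hα.continuous_ratio hg
  have hV1 := hasDerivAt_integral_of_continuous (hr0.mul hψ) (-m)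
  have hV2 := hasDerivAt_integral_of_continuous (hr.mul hψ) y₀
  have i1 := sub_mul_le_sub_mul_of_antitone (show -m ≤ y₀ by linarith)
    (fun x _ => (hV1 x).continuousAt.continuousWithinAt) hSc.continuousOn hr0.continuousOn
    (fun x _ => hV1 x) (fun x _ => hSd x)
    (fun x _ => (((hg.diff (x + m)).hasDerivAt.comp_add_const x m).div_const (g 0)))
    (fun x hx => div_nonpos_of_nonpos_of_nonneg (hg.deriv_nonpos (by linarith [hx.1]))
      (hg.pos 0).le)
    (fun x hx => hS0 x hx.1.le (hx.2.le.trans hy))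
  have hex : ∀ x ∈ Set.Ioo y₀ y, ∃ d ≤ 0,
      HasDerivAt (fun u => g (u + m) / g (α u - m)) d x := fun x hx =>
    hα.hasDerivAt_ratio hg hm (hy₀.trans_lt hx.1)
      (hαy₀ ▸ hα.monotoneOn hy₀ (hy₀.trans hx.1.le) hx.1.le)
  choose! d hd hdd using hex
  have i2 := sub_mul_le_sub_mul_of_antitone hy
    (fun x _ => (hV2 x).continuousAt.continuousWithinAt) hSc.continuousOn hr.continuousOn
    (fun x _ => hV2 x) (fun x _ => hSd x) hdd hd
    (fun x hx => hS0 x (by linarith [hx.1]) hx.2.le)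
  have hg0 : g 0 / g 0 = 1 := div_self (hg.pos 0).ne'
  have hpos : 0 ≤ g (y + m) / g (α y - m) * S y :=
    mul_nonneg (div_nonneg (hg.pos _).le (hg.pos _).le) (hS0 y (by linarith) le_rfl)
  simp only [intervalIntegral.integral_same, neg_add_cancel, hg0, hαy₀, sub_self, one_mul,
    zero_sub] at i1 i2
  have : matchedIntegral g α m y₀ ψ y = S (-m) + (∫ u in (-m)..y₀, g (u + m) / g 0 * ψ u) +
    ∫ u in y₀..y, g (u + m) / g (α u - m) * ψ u := rfl
  simp only [Pi.mul_apply] at i1 i2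
  linarith

lemma integral_mul_nonneg (hα : IsMatching g m k α) (hg : IsConvexProfile g) (hm : 0 ≤ m)
    (hy₀ : 0 ≤ y₀) (hαy₀ : α y₀ = m) {φ : ℝ → ℝ} (hφ : Continuous φ)
    (H : ∀ ρ > 0, ∃ c : ℝ, ∀ R ∈ Set.Icc (-ρ) (k * ρ), 0 ≤ ∫ u in (-ρ)..R, (φ u - c * u))
    {y : ℝ} (hy : y₀ ≤ y) (hypos : 0 < y) : 0 ≤ ∫ u in (-α y)..y, g (u + m) * φ u := by
  have hc := hg.diff.continuous
  have hgφ : Continuous fun u => g (u + m) * φ u := by fun_prop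
  have hZ0 : ∀ z, y₀ ≤ z → 0 < z → 0 ≤ matchedIntegral g α m y₀ φ z := by
    intro z hz hz0
    obtain ⟨c, hcR⟩ := H (α z) (hα.pos z hz0)
    have h1 := hα.matchedIntegral_nonneg_of_integral_nonneg hg hm hy₀ hαy₀
      (ψ := fun u => φ u - c * u) (by fun_prop) hz hcR
    rwa [hα.matchedIntegral_sub hg hφ continuous_id', hα.matchedIntegral_id hg hy₀ hαy₀ hz,
      mul_zero, sub_zero] at h1
  set V := fun z => ∫ u in (-α z)..z, g (u + m) * φ u with hV
  set G := fun z => ∫ u in (0 : ℝ)..z, g (u + m) * φ u with hG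
  have hGd : ∀ x, HasDerivAt G (g (x + m) * φ x) x := hasDerivAt_integral_of_continuous hgφ 0
  have hGc : Continuous G := continuous_iff_continuousAt.2 fun x => (hGd x).continuousAt
  have hVG : V = fun z => G z - G (-α z) := by
    ext z
    exact (intervalIntegral.integral_interval_sub_left (hgφ.intervalIntegrable _ _)
      (hgφ.intervalIntegrable _ _)).symm
  have hαc := hα.cont
  have hVc : Continuous V := by rw [hVG]; fun_prop
  have hVd : ∀ x ∈ Set.Ioo y₀ y, HasDerivAt V (g (α x - m) *
      (x * g (x + m) / (α x * g (α x - m)) * φ (-α x) + g (x + m) / g (α x - m) * φ x)) x := by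
    intro x hx
    have hx0 := hy₀.trans_lt hx.1
    have h1 := HasDerivAt.comp (h₂ := G) x (hGd (-α x)) (hα.hasDerivAt x hx0).neg
    rw [hVG]
    refine ((hGd x).sub h1).congr_deriv ?_
    have hg1 := hg.pos (α x - m)
    have ha := hα.pos x hx0
    rw [show g (-α x + m) = g (α x - m) by rw [← hg.symm]; ring_nf]
    field_simp
    ring
  have key := sub_mul_le_sub_mul_of_antitone hy hVc.continuousOn
    (hα.continuous_matchedIntegral hg hφ (y₀ := y₀)).continuousOn
    (w := fun z => g (α z - m)) (by fun_prop : Continuous fun z => g (α z - m)).continuousOn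
    hVd (fun x hx => hα.hasDerivAt_matchedIntegral hg hφ (hy₀.trans_lt hx.1))
    (fun x hx => HasDerivAt.comp (h₂ := g) x (hg.diff (α x - m)).hasDerivAt
      ((hα.hasDerivAt x (hy₀.trans_lt hx.1)).sub_const m))
    (fun x hx => by
      have hx0 := hy₀.trans_lt hx.1
      have hmx : m ≤ α x := hαy₀ ▸ hα.monotoneOn hy₀ hx0.le hx.1.le
      refine mul_nonpos_of_nonpos_of_nonneg (hg.deriv_nonpos (by linarith)) ?_
      have := hg.pos (α x - m)
      have := hg.pos (x + m)
      have := hα.pos x hx0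
      positivity)
    (fun x hx => hZ0 x hx.1.le (hy₀.trans_lt hx.1))
  have hstart : V y₀ - g (α y₀ - m) * matchedIntegral g α m y₀ φ y₀ = 0 := by
    have e : ∀ u, g (u + m) / g 0 * φ u = (g 0)⁻¹ * (g (u + m) * φ u) := fun u => by ring
    simp only [matchedIntegral, hαy₀, intervalIntegral.integral_same, e,
      intervalIntegral.integral_const_mul, hV, sub_self, zero_add, add_zero,
      mul_inv_cancel_left₀ (hg.pos 0).ne']
  have := mul_nonneg (hg.pos (α y - m)).le (hZ0 y hy hypos)
  simp only [hstart] at key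
  linarith

end IsMatching

theorem IsConvexProfile.integral_mul_nonneg {g : ℝ → ℝ} (hg : IsConvexProfile g)
    (hinteg : Integrable g) (h1 : ∫ x, g x = 1) {K : ℕ} (hK : 1 ≤ K) {m : ℝ} (hm : 0 ≤ m)
    (hlim : m ≤ Filter.liminf (fun t : ℝ => ∫ x in t..(K * t), x * g x) Filter.atTop)
    {φ : ℝ → ℝ} (hφ : Continuous φ) {C : ℝ} (hC : ∀ x, |φ x| ≤ C)
    (h : ∀ x : Fin (K + 1) → ℝ, ∑ i, x i = (K + 1) * m → 0 ≤ ∑ i, φ (x i)) :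
    0 ≤ ∫ x, g x * φ x := by
  have hK' : (1 : ℝ) ≤ K := by exact_mod_cast hK
  obtain ⟨α, hα⟩ := hg.exists_isMatching hm hK' fun x hx =>
    hg.leftMoment_le_rightMoment_mul hinteg h1 hm hK' hlim hx
  obtain ⟨y₀, hy₀, hαy₀⟩ := hα.exists_apply_eq hm hK'
  have H := fun (ρ : ℝ) (hρ : 0 < ρ) => exists_linear_integral_nonneg hK
    (φ := fun u => φ (u + m)) (by fun_prop)
    (fun x hx => h (fun i => x i + m) (by
      rw [Finset.sum_add_distrib, hx]; simp)) hρ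
  have hinteg' : Integrable fun u => g (u + m) * φ (u + m) :=
    (hinteg.mul_bdd (c := C) hφ.aestronglyMeasurable
      (Filter.Eventually.of_forall hC)).comp_add_right m
  have hbot : Filter.Tendsto (fun y => -α y) Filter.atTop Filter.atBot := by
    refine Filter.tendsto_neg_atTop_atBot.comp (Filter.tendsto_atTop_mono' _ ?_
      (Filter.tendsto_id.atTop_div_const (show (0 : ℝ) < K by linarith)))
    filter_upwards [Filter.eventually_ge_atTop 0] with y hy
    rw [id, div_le_iff₀ (by linarith), mul_comm]
    exact hα.le_mul y hy
  have htend := intervalIntegral_tendsto_integral hinteg' hbot Filter.tendsto_id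
  rw [integral_add_right_eq_self fun u => g u * φ u] at htend
  refine ge_of_tendsto htend ?_
  filter_upwards [Filter.eventually_ge_atTop y₀, Filter.eventually_gt_atTop 0] with y hy hy0
  exact hα.integral_mul_nonneg hg hm hy₀ hαy₀ (by fun_prop) H hy hy0

open scoped BoundedContinuousFunction CompactlySupported

lemma exists_positive_extension {V E : Type*} [AddCommGroup V] [Module ℝ V] [AddCommGroup E]
    [Module ℝ E] (T : V →ₗ[ℝ] E) (l : V →ₗ[ℝ] ℝ) (s : PointedCone ℝ E)
    (h : ∀ v, T v ∈ s → 0 ≤ l v) (hs : ∀ y, ∃ v, T v + y ∈ s) :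
    ∃ Λ : E →ₗ[ℝ] ℝ, (∀ v, Λ (T v) = l v) ∧ ∀ x ∈ s, 0 ≤ Λ x := by
  obtain ⟨σ, hσ⟩ := T.rangeRestrict.exists_rightInverse_of_surjective T.range_rangeRestrict
  have hTσ : ∀ w : LinearMap.range T, T (σ w) = w := fun w =>
    congrArg Subtype.val (LinearMap.congr_fun hσ w)
  have hker : ∀ v, T v = 0 → l v = 0 := fun v hv =>
    le_antisymm (by simpa using h (-v) (by simp [hv])) (h v (by simp [hv]))
  obtain ⟨Λ, hΛ, hpos⟩ := riesz_extension s ⟨LinearMap.range T, l ∘ₗ σ⟩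
    (fun w hw => h (σ w) (by rwa [hTσ]))
    (fun y => by
      obtain ⟨v, hv⟩ := hs y
      exact ⟨⟨T v, v, rfl⟩, hv⟩)
  refine ⟨Λ, fun v => ?_, hpos⟩
  have h1 := hΛ ⟨T v, v, rfl⟩
  refine h1.trans ?_
  change l (σ ⟨T v, v, rfl⟩) = l v
  rw [← sub_eq_zero, ← map_sub]
  exact hker _ (by rw [map_sub, hTσ, sub_self])

/-- A tight normalized positive functional on bounded continuous functions is integration
against a probability measure. -/
lemma exists_isProbabilityMeasure_of_tight {X : Type*} [TopologicalSpace X] [T2Space X]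
    [LocallyCompactSpace X] [MeasurableSpace X] [BorelSpace X] (Λ : (X →ᵇ ℝ) →ₗ[ℝ] ℝ)
    (hpos : ∀ ψ, (∀ x, 0 ≤ ψ x) → 0 ≤ Λ ψ) (hone : Λ 1 = 1)
    (htight : ∀ ε > 0, ∃ χ : C_c(X, ℝ), (∀ x, 0 ≤ χ x) ∧ (∀ x, χ x ≤ 1) ∧
      Λ (1 - χ.toBoundedContinuousFunction) ≤ ε) :
    ∃ P : Measure X, IsProbabilityMeasure P ∧ ∀ ψ : X →ᵇ ℝ, ∫ x, ψ x ∂P = Λ ψ := by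
  let Λc : C_c(X, ℝ) →ₚ[ℝ] ℝ := PositiveLinearMap.mk₀
    { toFun := fun f => Λ f.toBoundedContinuousFunction
      map_add' := fun f f' => by rw [← map_add]; rfl
      map_smul' := fun a f => by rw [RingHom.id_apply, ← map_smul]; rfl }
    (fun f hf => hpos _ hf)
  have hΛc : ∀ f : C_c(X, ℝ), Λc f = Λ f.toBoundedContinuousFunction := fun f => rfl
  set P := RealRMK.rieszMeasure Λc with hP
  have hmono : ∀ ψ ψ' : X →ᵇ ℝ, (∀ x, ψ x ≤ ψ' x) → Λ ψ ≤ Λ ψ' := fun ψ ψ' hle => by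
    have := hpos (ψ' - ψ) fun x => sub_nonneg.2 (hle x)
    rw [map_sub] at this
    linarith
  have huniv : P Set.univ ≤ 1 := by
    rw [isOpen_univ.measure_eq_iSup_isCompact]
    refine iSup₂_le fun K _ => iSup_le fun hK => ?_
    obtain ⟨f, hf1, hf2, -, hf3⟩ := exists_continuousMap_one_of_isCompact_subset_isOpen hK
      isOpen_univ (Set.subset_univ K)
    refine (RealRMK.rieszMeasure_le_of_eq_one Λc (f := ⟨f, hasCompactSupport_def.mpr hf2⟩)
      (fun x => (hf3 x).1) hK (fun x hx => hf1 hx)).trans ?_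
    rw [ENNReal.ofReal_le_one, hΛc, ← hone]
    exact hmono _ _ fun x => (hf3 x).2
  have hfin : IsFiniteMeasure P := ⟨huniv.trans_lt ENNReal.one_lt_top⟩
  have hreal : P.real Set.univ ≤ 1 := ENNReal.toReal_le_of_le_ofReal zero_le_one (by simpa)
  have hrep : ∀ ψ : X →ᵇ ℝ, ∫ x, ψ x ∂P = Λ ψ := by
    intro ψ
    refine eq_of_abs_sub_le_all fun ε hε => ?_
    obtain ⟨χ, hχ0, hχ1, hχ⟩ := htight (ε / (2 * (‖ψ‖ + 1))) (by positivity)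
    have hinteg : ∀ ψ : X →ᵇ ℝ, Integrable ψ P := fun ψ => ψ.integrable P
    set χb := χ.toBoundedContinuousFunction with hχb
    have hprod : ∫ x, (χb * ψ) x ∂P = Λ (χb * ψ) := by
      let f : C_c(X, ℝ) := ⟨⟨fun x => χ x * ψ x, by fun_prop⟩, χ.hasCompactSupport.mul_right⟩
      exact RealRMK.integral_rieszMeasure Λc f
    have hχint : ∫ x, χb x ∂P = Λ χb := RealRMK.integral_rieszMeasure Λc χ
    have hψ : ∀ x, |ψ x| ≤ ‖ψ‖ := ψ.norm_coe_le_norm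
    have hb : ∀ x, |((1 - χb) * ψ) x| ≤ (‖ψ‖ • (1 - χb)) x := by
      intro x
      have h0 : 0 ≤ 1 - χ x := sub_nonneg.2 (hχ1 x)
      have : ((1 - χb) * ψ) x = (1 - χ x) * ψ x := rfl
      rw [this, abs_mul, abs_of_nonneg h0, mul_comm]
      exact mul_le_mul_of_nonneg_right (hψ x) h0
    have e1 : |Λ ((1 - χb) * ψ)| ≤ ‖ψ‖ * Λ (1 - χb) := by
      have hsmul : Λ (‖ψ‖ • (1 - χb)) = ‖ψ‖ * Λ (1 - χb) := Λ.map_smul _ _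
      rw [← hsmul, abs_le, ← map_neg]
      exact ⟨hmono _ _ fun x => (abs_le.1 (hb x)).1, hmono _ _ fun x => (abs_le.1 (hb x)).2⟩
    have e2 : |∫ x, ((1 - χb) * ψ) x ∂P| ≤ ‖ψ‖ * Λ (1 - χb) := by
      refine (abs_integral_le_integral_abs).trans ?_
      refine (integral_mono (hinteg _).abs (hinteg (‖ψ‖ • (1 - χb))) hb).trans ?_
      have : ∫ x, (‖ψ‖ • (1 - χb)) x ∂P = ‖ψ‖ * (P.real Set.univ - ∫ x, χb x ∂P) := by
        have h1 : ∀ x, (‖ψ‖ • (1 - χb)) x = ‖ψ‖ * (1 - χb x) := fun x => rfl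
        simp_rw [h1]
        rw [integral_const_mul, integral_sub (integrable_const _) (hinteg _)]
        simp
      rw [this, hχint, map_sub, hone]
      exact mul_le_mul_of_nonneg_left (by linarith) (norm_nonneg _)
    have e3 : ψ = χb * ψ + (1 - χb) * ψ := by ring
    have e4 : ∫ x, ψ x ∂P = ∫ x, (χb * ψ) x ∂P + ∫ x, ((1 - χb) * ψ) x ∂P := by
      rw [← integral_add (hinteg _) (hinteg _)]
      congr 1 with x
      exact congrArg (fun f : X →ᵇ ℝ => f x) e3
    have e5 : Λ ψ = Λ (χb * ψ) + Λ ((1 - χb) * ψ) := by rw [← map_add, ← e3]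
    have e6 : ‖ψ‖ * Λ (1 - χb) ≤ ε / 2 := by
      refine (mul_le_mul_of_nonneg_left hχ (norm_nonneg _)).trans ?_
      rw [mul_div_assoc', div_le_div_iff₀ (by positivity) two_pos]
      nlinarith [norm_nonneg ψ]
    rw [e4, e5, hprod, add_sub_add_left_eq_sub]
    rw [abs_le] at *
    constructor <;> linarith [e1.1, e1.2, e2.1, e2.2]
  refine ⟨P, ⟨?_⟩, hrep⟩
  have h1 := hrep 1
  rw [hone] at h1
  simp only [BoundedContinuousFunction.coe_one, Pi.one_apply, integral_const, smul_eq_mul,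
    mul_one] at h1
  rw [← ENNReal.ofReal_toReal (measure_ne_top P Set.univ)]
  change ENNReal.ofReal (P.real Set.univ) = 1
  rw [h1, ENNReal.ofReal_one]

/-- The distance to `[-R, R]`, truncated at `1`. -/
noncomputable def clippedExcess (R : ℝ) : ℝ →ᵇ ℝ :=
  BoundedContinuousFunction.ofNormedAddCommGroup (fun t => min 1 (max 0 (|t| - R)))
    (by fun_prop) 1 fun t => by
      rw [Real.norm_eq_abs, abs_of_nonneg (le_min zero_le_one (le_max_left _ _))]
      exact min_le_left _ _

lemma clippedExcess_apply (R t : ℝ) : clippedExcess R t = min 1 (max 0 (|t| - R)) := rfl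

lemma clippedExcess_nonneg (R t : ℝ) : 0 ≤ clippedExcess R t :=
  le_min zero_le_one (le_max_left _ _)

lemma tendsto_integral_clippedExcess (μ : Measure ℝ) [IsProbabilityMeasure μ] :
    Filter.Tendsto (fun R => ∫ t, clippedExcess R t ∂μ) Filter.atTop (nhds 0) := by
  rw [← integral_zero ℝ ℝ (μ := μ)]
  refine tendsto_integral_filter_of_dominated_convergence (fun _ => 1)
    (.of_forall fun R => (clippedExcess R).continuous.aestronglyMeasurable)
    (.of_forall fun R => .of_forall fun t => ?_) (integrable_const _) (.of_forall fun t => ?_)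
  · rw [Real.norm_eq_abs, abs_of_nonneg (clippedExcess_nonneg R t)]
    exact min_le_left _ _
  · refine tendsto_const_nhds.congr' ?_
    filter_upwards [Filter.eventually_ge_atTop |t|] with R hR
    rw [clippedExcess_apply, max_eq_left (sub_nonpos.2 hR), min_eq_right zero_le_one]

/-- A compactly supported minorant of `1` on `ι → ℝ`. -/
lemma exists_one_sub_le_sum_clippedExcess {ι : Type*} [Fintype ι] (R : ℝ) :
    ∃ χ : C_c(ι → ℝ, ℝ), (∀ x, 0 ≤ χ x) ∧ (∀ x, χ x ≤ 1) ∧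
      ∀ x, 1 - χ x ≤ ∑ i, clippedExcess R (x i) := by
  refine ⟨⟨⟨fun x => max 0 (1 - ∑ i, clippedExcess R (x i)), by fun_prop⟩, ?_⟩, fun x => ?_,
    fun x => ?_, fun x => ?_⟩
  · refine HasCompactSupport.intro (isCompact_closedBall (0 : ι → ℝ) (|R| + 1)) fun x hx => ?_
    have : ∃ i, |R| + 1 < |x i| := by
      by_contra! h
      refine hx ?_
      rw [mem_closedBall_zero_iff, pi_norm_le_iff_of_nonneg (by positivity)]
      exact h
    obtain ⟨i, hi⟩ := this
    have h1 : clippedExcess R (x i) = 1 := by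
      rw [clippedExcess_apply, min_eq_left]
      exact le_max_of_le_right (by linarith [le_abs_self R])
    have h2 := Finset.single_le_sum (f := fun i => clippedExcess R (x i))
      (fun i _ => clippedExcess_nonneg R (x i)) (Finset.mem_univ i)
    exact max_eq_left (by simp only [h1] at h2; linarith)
  · exact le_max_left _ _
  · exact max_le zero_le_one
      (sub_le_self _ (Finset.sum_nonneg fun i _ => clippedExcess_nonneg R (x i)))
  · exact sub_le_comm.1 (le_max_right _ _)

/-- A nonnegative combination of coordinate functions on an affine hyperplane can be
symmetrized. -/
lemma sum_sum_nonneg_of_forall_sum_eq {n : ℕ} [NeZero n] {f : Fin n → ℝ → ℝ} {C : ℝ}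
    (h : ∀ x : Fin n → ℝ, ∑ i, x i = C → 0 ≤ ∑ i, f i (x i)) (x : Fin n → ℝ)
    (hx : ∑ i, x i = C) : 0 ≤ ∑ j, ∑ i, f i (x j) := by
  have h1 : ∑ j, ∑ i, f i (x j) = ∑ k, ∑ i, f i (x (i + k)) := by
    rw [Finset.sum_comm, Finset.sum_comm (f := fun k i => f i (x (i + k)))]
    exact Finset.sum_congr rfl fun i _ =>
      (Equiv.sum_comp (Equiv.addLeft i) fun j => f i (x j)).symm
  rw [h1]
  exact Finset.sum_nonneg fun k _ => h (fun i => x (i + k))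
    ((Equiv.sum_comp (Equiv.addRight k) x).trans hx)

/-- Duality for complete mixability: it suffices to test bounded continuous functions whose sum
over the coordinates is nonnegative on the hyperplane. -/
theorem isCompletelyMixable_of_forall_integral_nonneg {n : ℕ} [NeZero n] {μ : Measure ℝ}
    [IsProbabilityMeasure μ] {c : ℝ}
    (h : ∀ φ : ℝ →ᵇ ℝ, (∀ x : Fin n → ℝ, ∑ i, x i = n * c → 0 ≤ ∑ i, φ (x i)) →
      0 ≤ ∫ t, φ t ∂μ) :
    IsCompletelyMixable n μ c := by
  have hinteg : ∀ φ : ℝ →ᵇ ℝ, Integrable φ μ := fun φ => φ.integrable μ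
  let T : (Fin n → ℝ →ᵇ ℝ) →ₗ[ℝ] ((Fin n → ℝ) →ᵇ ℝ) :=
    { toFun := fun φ => ∑ i, (φ i).compContinuous ⟨fun x => x i, continuous_apply i⟩
      map_add' := fun φ φ' => by
        ext x
        simp [BoundedContinuousFunction.sum_apply, Finset.sum_add_distrib]
      map_smul' := fun a φ => by
        ext x
        simp [BoundedContinuousFunction.sum_apply, Finset.mul_sum] }
  have hT : ∀ φ x, T φ x = ∑ i, φ i (x i) := fun φ x => by
    simp [T, BoundedContinuousFunction.sum_apply]
  let l : (Fin n → ℝ →ᵇ ℝ) →ₗ[ℝ] ℝ :=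
    { toFun := fun φ => ∑ i, ∫ t, φ i t ∂μ
      map_add' := fun φ φ' => by
        rw [← Finset.sum_add_distrib]
        exact Finset.sum_congr rfl fun i _ => integral_add (hinteg _) (hinteg _)
      map_smul' := fun a φ => by
        rw [RingHom.id_apply, smul_eq_mul, Finset.mul_sum]
        exact Finset.sum_congr rfl fun i _ => integral_const_mul _ _ }
  have hl : ∀ φ, l φ = ∑ i, ∫ t, φ i t ∂μ := fun φ => rfl
  let s : PointedCone ℝ ((Fin n → ℝ) →ᵇ ℝ) :=
    { carrier := {ψ | ∀ x : Fin n → ℝ, ∑ i, x i = n * c → 0 ≤ ψ x}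
      add_mem' := fun hψ hψ' x hx => add_nonneg (hψ x hx) (hψ' x hx)
      zero_mem' := fun x _ => le_rfl
      smul_mem' := fun a ψ hψ x hx => mul_nonneg a.2 (hψ x hx) }
  have hs : ∀ ψ, ψ ∈ s ↔ ∀ x, ∑ i, x i = n * c → 0 ≤ ψ x := fun ψ => Iff.rfl
  have hTsingle : ∀ i φ x, T (Pi.single i φ) x = φ (x i) := fun i φ x => by
    rw [hT, Finset.sum_eq_single i (fun j _ hj => by simp [hj]) (by simp), Pi.single_eq_same]
  have hlsingle : ∀ i φ, l (Pi.single i φ) = ∫ t, φ t ∂μ := fun i φ => by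
    rw [hl, Finset.sum_eq_single i (fun j _ hj => by simp [hj]) (by simp), Pi.single_eq_same]
  obtain ⟨Λ, hΛT, hΛs⟩ := exists_positive_extension T l s
    (fun φ hφ => by
      have h1 := h (∑ i, φ i) fun x hx => by
        simp only [BoundedContinuousFunction.sum_apply]
        exact sum_sum_nonneg_of_forall_sum_eq
          (fun y hy => by simpa only [hT] using (hs _).1 hφ y hy) x hx
      simp only [BoundedContinuousFunction.sum_apply] at h1
      rwa [integral_finsetSum _ fun i _ => hinteg _] at h1)
    (fun ψ => ⟨Pi.single 0 (BoundedContinuousFunction.const ℝ ‖ψ‖), fun x _ => by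
      rw [BoundedContinuousFunction.add_apply, hTsingle, BoundedContinuousFunction.const_apply]
      linarith [(abs_le.1 (ψ.norm_coe_le_norm x)).1]⟩)
  have hmono : ∀ ψ ψ' : (Fin n → ℝ) →ᵇ ℝ, (∀ x, ψ x ≤ ψ' x) → Λ ψ ≤ Λ ψ' := fun ψ ψ' hle => by
    have := hΛs (ψ' - ψ) fun x _ => sub_nonneg.2 (hle x)
    rw [map_sub] at this
    linarith
  have hone : Λ 1 = 1 := by
    have h1 : T (Pi.single 0 1) = 1 := by
      ext x
      rw [hTsingle]
      rfl
    rw [← h1, hΛT, hlsingle]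
    simp
  obtain ⟨P, hP, hPΛ⟩ := exists_isProbabilityMeasure_of_tight Λ
    (fun ψ hψ => hΛs ψ fun x _ => hψ x) hone (fun ε hε => by
      have hn : (0 : ℝ) < n := by exact_mod_cast NeZero.pos n
      obtain ⟨R, hR⟩ := ((tendsto_integral_clippedExcess μ).eventually
        (gt_mem_nhds (div_pos hε hn))).exists
      obtain ⟨χ, hχ0, hχ1, hχ⟩ := exists_one_sub_le_sum_clippedExcess (ι := Fin n) R
      refine ⟨χ, hχ0, hχ1, ?_⟩
      refine (hmono _ (T fun _ => clippedExcess R) fun x => (hχ x).trans_eq (hT _ _).symm).trans ?_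
      rw [hΛT, hl, Finset.sum_const, Finset.card_univ, Fintype.card_fin, nsmul_eq_mul]
      rw [lt_div_iff₀ hn] at hR
      linarith)
  refine ⟨P, hP, fun i => ?_, ?_⟩
  · have hm : Measurable fun x : Fin n → ℝ => x i := measurable_pi_apply i
    have : IsProbabilityMeasure (P.map fun x => x i) :=
      Measure.isProbabilityMeasure_map hm.aemeasurable
    refine ext_of_forall_integral_eq_of_IsFiniteMeasure fun φ => ?_
    rw [integral_map hm.aemeasurable φ.continuous.aestronglyMeasurable, ← hlsingle i, ← hΛT,
      ← hPΛ]
    simp_rw [hTsingle]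
  · let ψ : (Fin n → ℝ) →ᵇ ℝ := BoundedContinuousFunction.ofNormedAddCommGroup
      (fun x => min 1 |∑ i, x i - n * c|) (by fun_prop) 1 fun x => by
        rw [Real.norm_eq_abs, abs_of_nonneg (le_min zero_le_one (abs_nonneg _))]
        exact min_le_left _ _
    have hψ : ∀ x, ψ x = min 1 |∑ i, x i - n * c| := fun x => rfl
    have hψ0 : ∀ x, 0 ≤ ψ x := fun x => le_min zero_le_one (abs_nonneg _)
    have h0 : ∫ x, ψ x ∂P = 0 := by
      refine le_antisymm ?_ (integral_nonneg hψ0)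
      have h1 := hΛs (-ψ) fun x hx => by
        rw [BoundedContinuousFunction.neg_apply, hψ, hx, sub_self, abs_zero]
        simp
      rw [map_neg] at h1
      rw [hPΛ]
      linarith
    rw [integral_eq_zero_iff_of_nonneg hψ0 (ψ.integrable P)] at h0
    refine prob_compl_eq_zero_iff₀ ?_ |>.1 ?_
    · exact (measurableSet_eq_fun (by fun_prop) measurable_const).nullMeasurableSet
    · refine measure_mono_null (fun x hx => ?_) (ae_iff.1 h0)
      intro h2
      refine hx ?_
      rw [hψ, Pi.zero_apply] at h2
      rcases min_choice 1 |∑ i, x i - n * c| with h3 | h3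
      · rw [h3] at h2
        exact absurd h2 one_ne_zero
      · rw [h3] at h2
        exact sub_eq_zero.1 (abs_eq_zero.1 h2)

theorem stmt18 (n : ℕ) (hn : 2 ≤ n) (g : ℝ → ℝ)
    (hpos : ∀ x, 0 < g x) (hdiff : Differentiable ℝ g)
    (hsymm : ∀ x, g (-x) = g x)
    (hinc : ∀ x < (0 : ℝ), 0 < deriv g x) (hdec : ∀ x > (0 : ℝ), deriv g x < 0)
    (hconv : ConvexOn ℝ Set.univ (fun x => (Real.sqrt (g x))⁻¹))
    (ν : Measure ℝ) [IsProbabilityMeasure ν]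
    (hν : ν = volume.withDensity (fun x => ENNReal.ofReal (g x)))
    (q : ℝ)
    (hq : |q| ≤ Filter.liminf (fun t : ℝ => ∫ x in t..(((n : ℝ) - 1) * t), x * g x) Filter.atTop) :
    IsCompletelyMixable n ν q := by
  obtain ⟨K, rfl⟩ : ∃ K, n = K + 1 := ⟨n - 1, by omega⟩
  have hg : IsConvexProfile g := ⟨hpos, hdiff, hsymm, hdec, hconv⟩
  have hmeas : Measurable g := hdiff.continuous.measurable
  have hlint : ∫⁻ x, ENNReal.ofReal (g x) = 1 := by
    have h1 := measure_univ (μ := ν)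
    rwa [hν, withDensity_apply _ MeasurableSet.univ, Measure.restrict_univ] at h1
  have hinteg : Integrable g := by
    refine ⟨hmeas.aestronglyMeasurable, ?_⟩
    rw [hasFiniteIntegral_iff_ofReal (.of_forall fun x => (hpos x).le), hlint]
    exact ENNReal.one_lt_top
  have hone : ∫ x, g x = 1 := by
    rw [integral_eq_lintegral_of_nonneg_ae (.of_forall fun x => (hpos x).le)
      hmeas.aestronglyMeasurable, hlint, ENNReal.toReal_one]
  have hνint : ∀ φ : ℝ → ℝ, ∫ x, φ x ∂ν = ∫ x, g x * φ x := fun φ => by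
    rw [hν, integral_withDensity_eq_integral_toReal_smul hmeas.ennreal_ofReal
      (.of_forall fun x => ENNReal.ofReal_lt_top)]
    simp_rw [ENNReal.toReal_ofReal (hpos _).le, smul_eq_mul]
  push_cast at hq
  rw [add_sub_cancel_right] at hq
  refine isCompletelyMixable_of_forall_integral_nonneg fun φ hφ => ?_
  push_cast at hφ
  rw [hνint]
  rcases le_total 0 q with h0 | h0
  · rw [abs_of_nonneg h0] at hq
    exact hg.integral_mul_nonneg hinteg hone (by omega) h0 hq φ.continuous φ.norm_coe_le_norm hφ
  · rw [abs_of_nonpos h0] at hq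
    have h1 := hg.integral_mul_nonneg hinteg hone (by omega) (neg_nonneg.2 h0) hq
      (φ := fun x => φ (-x)) (by fun_prop) (fun x => φ.norm_coe_le_norm (-x)) fun x hx =>
        hφ (fun i => -x i) (by rw [Finset.sum_neg_distrib, hx]; ring)
    rw [← integral_neg_eq_self] at h1
    simpa only [hsymm, neg_neg] using h1
end

section
/- Let ν be the Borel probability measure on ℝ with ν({2ᵏ}) = 2^{−(k+1)} for every integer k ≥ 0, let γ be the Borel probability measure with γ({−2^{k+1}}) = 2^{−(k+1)} for every integer k ≥ 0, and let μ = (2ν + γ)/3. Then the set of 3-centers of μ is exactly {0, 1/3}. -/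
open MeasureTheory ENNReal

/-- The weights `2 ^ (-(k + 1))` on the natural numbers. -/
noncomputable def halfGeometric : Measure ℕ :=
  Measure.sum fun k : ℕ => ((2 : ℝ≥0∞) ^ (k + 1))⁻¹ • Measure.dirac k

theorem tsum_inv_two_pow_succ : ∑' k : ℕ, ((2 : ℝ≥0∞) ^ (k + 1))⁻¹ = 1 := by
  simp_rw [ENNReal.inv_pow]
  rw [ENNReal.tsum_geometric_add_one, ENNReal.one_sub_inv_two, inv_inv]
  exact ENNReal.inv_mul_cancel (by simp) (by simp)

instance : IsProbabilityMeasure halfGeometric :=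
  ⟨by simp [halfGeometric, tsum_inv_two_pow_succ]⟩

theorem halfGeometric_map_apply (a : ℕ → ℝ) {s : Set ℝ} (hs : MeasurableSet s) :
    halfGeometric.map a s = ∑' k, ((2 : ℝ≥0∞) ^ (k + 1))⁻¹ * s.indicator 1 (a k) := by
  rw [Measure.map_apply (measurable_of_countable a) hs, halfGeometric,
    Measure.sum_apply _ (MeasurableSet.of_discrete)]
  refine tsum_congr fun k => ?_
  simp only [Measure.smul_apply, Measure.dirac_apply, smul_eq_mul]
  rfl

section Atoms

variable {ρ : Measure ℝ} {a : ℕ → ℝ}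

theorem measure_range_inter_eq_tsum (ha : Function.Injective a) {s : Set ℝ}
    (hs : MeasurableSet s) : ρ (Set.range a ∩ s) = ∑' k, ρ ({a k} ∩ s) := by
  rw [← Set.iUnion_singleton_eq_range, Set.iUnion_inter, measure_iUnion]
  · intro i j hij
    refine Set.disjoint_left.2 ?_
    rintro x ⟨hx, -⟩ ⟨hy, -⟩
    exact hij (ha (hx.symm.trans hy))
  · exact fun k => (measurableSet_singleton _).inter hs

theorem measure_compl_range_eq_zero [IsProbabilityMeasure ρ] (ha : Function.Injective a)
    (h : ∀ k, ρ {a k} = ((2 : ℝ≥0∞) ^ (k + 1))⁻¹) : ρ (Set.range a)ᶜ = 0 := by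
  rw [prob_compl_eq_zero_iff (Set.countable_range a).measurableSet]
  have := measure_range_inter_eq_tsum (ρ := ρ) ha MeasurableSet.univ
  simpa [h, tsum_inv_two_pow_succ] using this

theorem eq_halfGeometric_map [IsProbabilityMeasure ρ] (ha : Function.Injective a)
    (h : ∀ k, ρ {a k} = ((2 : ℝ≥0∞) ^ (k + 1))⁻¹) : ρ = halfGeometric.map a := by
  ext s hs
  have h0 := measure_compl_range_eq_zero ha h
  have h1 : ρ s = ρ (Set.range a ∩ s) := by
    rw [Set.inter_comm]
    exact (measure_inter_conull h0).symm
  rw [h1, measure_range_inter_eq_tsum ha hs, halfGeometric_map_apply a hs]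
  refine tsum_congr fun k => ?_
  by_cases hk : a k ∈ s
  · simp [Set.singleton_inter_of_mem hk, h, hk]
  · simp [Set.singleton_inter_eq_empty.2 hk, hk]

end Atoms

/-- Cyclically permuting the coordinates of a triple with constant sum mixes the average of
the laws of its entries. -/
theorem isCompletelyMixable_average (a b d : ℕ → ℝ) (c : ℝ)
    (h : ∀ k, a k + b k + d k = 3 * c) :
    IsCompletelyMixable 3 ((3 : ℝ≥0∞)⁻¹ • (halfGeometric.map a + halfGeometric.map b +
      halfGeometric.map d)) c := by
  have hm : ∀ f : ℕ → Fin 3 → ℝ, Measurable f := measurable_of_countable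
  have hi : ∀ (f : ℕ → Fin 3 → ℝ) (i : Fin 3),
      (halfGeometric.map f).map (fun x => x i) = halfGeometric.map (fun k => f k i) :=
    fun f i => Measure.map_map (measurable_pi_apply i) (hm f)
  let P : Measure (Fin 3 → ℝ) := (3 : ℝ≥0∞)⁻¹ • (halfGeometric.map (fun k => ![a k, b k, d k]) +
    halfGeometric.map (fun k => ![b k, d k, a k]) + halfGeometric.map (fun k => ![d k, a k, b k]))
  have h3 : (3 : ℝ≥0∞)⁻¹ * (1 + 1 + 1) = 1 := by
    rw [show (1 + 1 + 1 : ℝ≥0∞) = 3 by norm_num]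
    exact ENNReal.inv_mul_cancel (by simp) (by simp)
  refine ⟨P, ⟨?_⟩, fun i => ?_, ?_⟩
  · simpa [P, Measure.map_apply (hm _) MeasurableSet.univ, mul_add] using h3
  · simp only [P]
    rw [Measure.map_smul, Measure.map_add _ _ (measurable_pi_apply i),
      Measure.map_add _ _ (measurable_pi_apply i), hi, hi, hi]
    refine congrArg _ ?_
    fin_cases i
    · rfl
    · change halfGeometric.map b + halfGeometric.map d + halfGeometric.map a = _
      abel
    · change halfGeometric.map d + halfGeometric.map a + halfGeometric.map b = _
      abel
  · have hs : MeasurableSet {x : Fin 3 → ℝ | ∑ i, x i = (3 : ℕ) * c} :=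
      measurableSet_eq_fun (by fun_prop) measurable_const
    have key : ∀ f : ℕ → Fin 3 → ℝ, (∀ k, ∑ i, f k i = (3 : ℕ) * c) →
        halfGeometric.map f {x | ∑ i, x i = (3 : ℕ) * c} = 1 := by
      intro f hf
      rw [Measure.map_apply (hm f) hs]
      simp [Set.preimage, hf]
    simp only [P, Measure.smul_apply, Measure.add_apply, smul_eq_mul]
    rw [key, key, key, h3] <;> intro k <;> simp [Fin.sum_univ_three] <;> linarith [h k]

/-- An integer that is `1` or plus or minus a power of two with positive exponent. -/
def IsOneOrSignedTwoPow (n : ℤ) : Prop :=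
  n = 1 ∨ ∃ k : ℕ, n = 2 ^ (k + 1) ∨ n = -2 ^ (k + 1)

/-- Weak duality for complete mixability of laws concentrated on the integers satisfying `T`. -/
theorem IsCompletelyMixable.integral_nonneg {μ : Measure ℝ} {c : ℝ}
    (hc : IsCompletelyMixable 3 μ c) {T : ℤ → Prop}
    (hμ : ∀ᵐ (x : ℝ) ∂μ, ∃ n : ℤ, x = n ∧ T n) {f : ℝ → ℝ} (hf : Integrable f μ)
    (h : ∀ l m n : ℤ, T l → T m → T n → (l + m + n : ℝ) = 3 * c →
      0 ≤ f l + f m + f n) : 0 ≤ ∫ x, f x ∂μ := by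
  obtain ⟨P, hP, hmap, hsum⟩ := hc
  have hmeas : ∀ i : Fin 3, AEMeasurable (fun x : Fin 3 → ℝ => x i) P :=
    fun i => (measurable_pi_apply i).aemeasurable
  have hT : ∀ i : Fin 3, ∀ᵐ (x : Fin 3 → ℝ) ∂P, ∃ n : ℤ, x i = n ∧ T n := fun i =>
    ae_of_ae_map (hmeas i) (by rw [hmap i]; exact hμ)
  have hfi : ∀ i : Fin 3, Integrable (fun x : Fin 3 → ℝ => f (x i)) P := fun i =>
    Integrable.comp_aemeasurable ((hmap i).symm ▸ hf) (hmeas i)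
  have hint : ∀ i : Fin 3, ∫ x, f (x i) ∂P = ∫ x, f x ∂μ := by
    intro i
    have hf' : AEStronglyMeasurable f (P.map fun x => x i) :=
      ((hmap i).symm ▸ hf : Integrable f (P.map fun x => x i)).aestronglyMeasurable
    rw [← integral_map (hmeas i) hf', hmap i]
  have hs : MeasurableSet {x : Fin 3 → ℝ | ∑ i, x i = (3 : ℕ) * c} :=
    measurableSet_eq_fun (by fun_prop) measurable_const
  have hsum' : ∀ᵐ x ∂P, ∑ i, x i = (3 : ℕ) * c := (prob_compl_eq_zero_iff hs).2 hsum
  have hpos : 0 ≤ ∫ x, (f (x 0) + f (x 1) + f (x 2)) ∂P := by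
    refine integral_nonneg_of_ae ?_
    filter_upwards [hT 0, hT 1, hT 2, hsum'] with x ⟨l, hl, hl'⟩ ⟨m, hm, hm'⟩ ⟨n, hn, hn'⟩ hx
    rw [Fin.sum_univ_three, hl, hm, hn] at hx
    simpa [hl, hm, hn] using h l m n hl' hm' hn' (by simpa using hx)
  have h01 : Integrable (fun x : Fin 3 → ℝ => f (x 0) + f (x 1)) P := (hfi 0).add (hfi 1)
  rw [integral_add h01 (hfi 2), integral_add (hfi 0) (hfi 1),
    hint, hint, hint] at hpos
  linarith

theorem IsOneOrSignedTwoPow.one_or_even {n : ℤ} (h : IsOneOrSignedTwoPow n) :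
    n = 1 ∨ n % 2 = 0 := by
  rcases h with h | ⟨k, h | h⟩
  · exact Or.inl h
  all_goals right; rw [pow_succ] at h; omega

theorem IsOneOrSignedTwoPow.cases_mod_four {n : ℤ} (h : IsOneOrSignedTwoPow n) :
    n = 1 ∨ n = 2 ∨ n = -2 ∨ n % 4 = 0 := by
  rcases h with h | ⟨_ | k, h | h⟩
  · exact Or.inl h
  · simp at h; omega
  · simp at h; omega
  all_goals rw [pow_succ, pow_succ] at h; omega

/-- A nonzero sum of `2 ^ K` and an even signed power of two is at least `2 ^ (K - 1)`
in absolute value. -/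
theorem two_pow_le_of_add_ne_zero {K : ℕ} {n : ℤ} (hn : IsOneOrSignedTwoPow n) (hn1 : n ≠ 1)
    (h : 2 ^ K + n ≠ 0) : 2 ^ K ≤ 2 * |2 ^ K + n| := by
  have hK : (0 : ℤ) < 2 ^ K := by positivity
  rcases hn with rfl | ⟨k, rfl | rfl⟩
  · exact absurd rfl hn1
  · have : (0 : ℤ) < 2 ^ (k + 1) := by positivity
    rw [abs_of_pos (by positivity)]
    linarith
  · rcases lt_trichotomy (k + 1) K with hk | hk | hk
    · have : (2 : ℤ) ^ (k + 1 + 1) ≤ 2 ^ K := pow_le_pow_right₀ (by norm_num) hk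
      rw [pow_succ _ (k + 1)] at this
      linarith [le_abs_self ((2 : ℤ) ^ K + -2 ^ (k + 1))]
    · rw [hk] at h
      simp at h
    · have : (2 : ℤ) ^ (K + 1) ≤ 2 ^ (k + 1) := pow_le_pow_right₀ (by norm_num) hk
      rw [pow_succ _ K] at this
      linarith [neg_le_abs ((2 : ℤ) ^ K + -2 ^ (k + 1))]

section Uniqueness

variable {μ : Measure ℝ} {c : ℝ}

theorem integrable_indicator_singleton_one [IsFiniteMeasure μ] (a : ℝ) :
    Integrable (fun x => Set.indicator {a} (1 : ℝ → ℝ) x) μ :=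
  (integrable_const (1 : ℝ)).indicator (measurableSet_singleton a)

theorem integral_indicator_singleton_one (a : ℝ) :
    ∫ x, Set.indicator {a} (1 : ℝ → ℝ) x ∂μ = μ.real {a} :=
  integral_indicator_one (measurableSet_singleton a)

theorem indicator_singleton_intCast (a n : ℤ) :
    Set.indicator {(a : ℝ)} (1 : ℝ → ℝ) n = ((if n = a then 1 else 0 : ℤ) : ℝ) := by
  simp [Set.indicator_apply]

/-- If the centre of a completely mixable law on `{1, ±2, ±4, …}` is `C / 3` with `C` odd, the
mass at `1` exceeds `1 / 3` unless `C = 1` or the support is bounded. -/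
theorem measureReal_two_pow_le_of_odd [IsProbabilityMeasure μ]
    (hc : IsCompletelyMixable 3 μ c)
    (hμ : ∀ᵐ (x : ℝ) ∂μ, ∃ n : ℤ, x = n ∧ IsOneOrSignedTwoPow n) {C : ℤ} (hC : (C : ℝ) = 3 * c)
    (hodd : C % 2 = 1) (hC1 : C ≠ 1) {K : ℕ} (hK : 2 * |C - 1| < 2 ^ K) :
    1 / 3 + μ.real {(2 : ℝ) ^ K} ≤ μ.real {1} := by
  have hi := integrable_indicator_singleton_one (μ := μ)
  have hK1 : (1 : ℤ) < 2 ^ K := by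
    have : 0 < |C - 1| := abs_pos.2 (sub_ne_zero.2 hC1)
    omega
  have hd : Integrable (fun x => Set.indicator {((1 : ℤ) : ℝ)} (1 : ℝ → ℝ) x -
    Set.indicator {((2 ^ K : ℤ) : ℝ)} 1 x) μ := (hi _).sub (hi _)
  have key := hc.integral_nonneg hμ (hd.sub (integrable_const (1 / 3))) ?_
  · simp only [Pi.sub_apply] at key
    rw [integral_sub hd (integrable_const _), integral_sub (hi _) (hi _),
      integral_indicator_singleton_one, integral_indicator_singleton_one] at key
    simp at key
    simp
    linarith
  · intro l m n hl hm hn hs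
    rw [← hC] at hs
    norm_cast at hs
    have hne : ∀ p q : ℤ, IsOneOrSignedTwoPow q → q ≠ 1 → p + q = C - 1 → p ≠ 2 ^ K := by
      rintro p q hq hq1 hpq rfl
      have := two_pow_le_of_add_ne_zero (K := K) hq hq1 (by omega)
      rw [hpq] at this
      omega
    have key' : 1 ≤ ((if l = 1 then 1 else 0 : ℤ) - (if l = 2 ^ K then 1 else 0)) +
        ((if m = 1 then 1 else 0) - (if m = 2 ^ K then 1 else 0)) +
        ((if n = 1 then 1 else 0) - (if n = 2 ^ K then 1 else 0)) := by
      have h1 := hne l m hm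
      have h2 := hne l n hn
      have h3 := hne m l hl
      have h4 := hne m n hn
      have h5 := hne n l hl
      have h6 := hne n m hm
      generalize (2 : ℤ) ^ K = z at *
      rcases hl.one_or_even with hl | hl <;> rcases hm.one_or_even with hm | hm <;>
        rcases hn.one_or_even with hn | hn <;> split_ifs <;> omega
    have key'' := (Int.cast_le (R := ℝ)).2 key'
    simp only [Pi.sub_apply, indicator_singleton_intCast]
    push_cast at key'' ⊢
    linarith

theorem measureReal_one_le_of_even [IsProbabilityMeasure μ]
    (hc : IsCompletelyMixable 3 μ c)
    (hμ : ∀ᵐ (x : ℝ) ∂μ, ∃ n : ℤ, x = n ∧ IsOneOrSignedTwoPow n) {C : ℤ} (hC : (C : ℝ) = 3 * c)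
    (heven : C % 2 = 0) : μ.real {1} ≤ 2 * μ.real {((C - 2 : ℤ) : ℝ)} := by
  have hi := integrable_indicator_singleton_one (μ := μ)
  have key := hc.integral_nonneg hμ (f := fun x => 2 * Set.indicator {((C - 2 : ℤ) : ℝ)} 1 x -
    Set.indicator {((1 : ℤ) : ℝ)} 1 x) (((hi _).const_mul 2).sub (hi _)) ?_
  · rw [integral_sub ((hi _).const_mul 2) (hi _), integral_const_mul,
      integral_indicator_singleton_one, integral_indicator_singleton_one] at key
    simp only [Int.cast_one] at key
    linarith
  · intro l m n hl hm hn hs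
    rw [← hC] at hs
    norm_cast at hs
    have key' : 0 ≤ (2 * (if l = C - 2 then 1 else 0 : ℤ) - (if l = 1 then 1 else 0)) +
        (2 * (if m = C - 2 then 1 else 0) - (if m = 1 then 1 else 0)) +
        (2 * (if n = C - 2 then 1 else 0) - (if n = 1 then 1 else 0)) := by
      rcases hl.one_or_even with hl | hl <;> rcases hm.one_or_even with hm | hm <;>
        rcases hn.one_or_even with hn | hn <;> split_ifs <;> omega
    have key'' := (Int.cast_le (R := ℝ)).2 key'
    simp only [indicator_singleton_intCast]
    push_cast at key'' ⊢
    exact key''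

theorem measureReal_le_of_eq_four [IsProbabilityMeasure μ]
    (hc : IsCompletelyMixable 3 μ c)
    (hμ : ∀ᵐ (x : ℝ) ∂μ, ∃ n : ℤ, x = n ∧ IsOneOrSignedTwoPow n) (hC : 4 = 3 * c) :
    μ.real {1} + μ.real {-2} ≤ 2 * μ.real {2} + 2 * μ.real {8} := by
  have hi := integrable_indicator_singleton_one (μ := μ)
  have hp : Integrable (fun x => 2 * Set.indicator {((2 : ℤ) : ℝ)} (1 : ℝ → ℝ) x +
    2 * Set.indicator {((8 : ℤ) : ℝ)} 1 x) μ := ((hi _).const_mul 2).add ((hi _).const_mul 2)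
  have hq : Integrable (fun x => Set.indicator {((1 : ℤ) : ℝ)} (1 : ℝ → ℝ) x +
    Set.indicator {((-2 : ℤ) : ℝ)} 1 x) μ := (hi _).add (hi _)
  have key := hc.integral_nonneg hμ (hp.sub hq) ?_
  · simp only [Pi.sub_apply] at key
    rw [integral_sub hp hq,
      integral_add ((hi _).const_mul 2) ((hi _).const_mul 2), integral_add (hi _) (hi _),
      integral_const_mul, integral_const_mul] at key
    simp only [integral_indicator_singleton_one] at key
    push_cast at key
    linarith
  · intro l m n hl hm hn hs
    rw [← hC] at hs
    norm_cast at hs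
    have hval : ∀ {p : ℤ}, IsOneOrSignedTwoPow p → ∃ v : ℤ,
        2 * Set.indicator {((2 : ℤ) : ℝ)} (1 : ℝ → ℝ) p +
          2 * Set.indicator {((8 : ℤ) : ℝ)} (1 : ℝ → ℝ) p -
          (Set.indicator {((1 : ℤ) : ℝ)} (1 : ℝ → ℝ) p +
            Set.indicator {((-2 : ℤ) : ℝ)} (1 : ℝ → ℝ) p) = v ∧
        ((p = 1 ∧ v = -1) ∨ (p = 2 ∧ v = 2) ∨ (p = -2 ∧ v = -1) ∨ (p = 8 ∧ v = 2) ∨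
          (p % 4 = 0 ∧ p ≠ 8 ∧ v = 0)) := by
      intro p hp
      refine ⟨2 * (if p = 2 then 1 else 0 : ℤ) + 2 * (if p = 8 then 1 else 0) -
          ((if p = 1 then 1 else 0) + (if p = -2 then 1 else 0)), ?_, ?_⟩
      · simp only [indicator_singleton_intCast]
        push_cast
        rfl
      have := hp.cases_mod_four
      split_ifs <;> omega
    obtain ⟨u, hu, hu'⟩ := hval hl
    obtain ⟨v, hv, hv'⟩ := hval hm
    obtain ⟨w, hw, hw'⟩ := hval hn
    simp only [Pi.sub_apply, hu, hv, hw]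
    have key' : 0 ≤ u + v + w := by omega
    exact_mod_cast key'

theorem exists_int_eq_three_mul_center [IsProbabilityMeasure μ]
    (hc : IsCompletelyMixable 3 μ c)
    (hμ : ∀ᵐ (x : ℝ) ∂μ, ∃ n : ℤ, x = n ∧ IsOneOrSignedTwoPow n) : ∃ C : ℤ, (C : ℝ) = 3 * c := by
  by_contra! hne
  have key := hc.integral_nonneg hμ (f := fun _ => -1) (integrable_const _) ?_
  · norm_num at key
  · intro l m n _ _ _ hs
    exact absurd (by push_cast; exact hs) (hne (l + m + n))

end Uniqueness

theorem two_pow_injective : Function.Injective fun k : ℕ => (2 : ℝ) ^ k :=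
  pow_right_injective₀ (by norm_num) (by norm_num)

theorem neg_two_pow_succ_injective : Function.Injective fun k : ℕ => -(2 : ℝ) ^ (k + 1) :=
  fun _ _ h => Nat.succ_injective (two_pow_injective (neg_injective h))

/-- Both halves of the law of `2 ^ k` together consist of an atom at `1` and the law of
`2 ^ (k + 1)`. -/
theorem halfGeometric_map_two_pow_add_self :
    halfGeometric.map (fun k => (2 : ℝ) ^ k) + halfGeometric.map (fun k => (2 : ℝ) ^ k) =
      halfGeometric.map (fun _ => (1 : ℝ)) + halfGeometric.map (fun k => (2 : ℝ) ^ (k + 1)) := by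
  ext s hs
  rw [Measure.add_apply, Measure.add_apply, Measure.map_const]
  simp only [halfGeometric_map_apply _ hs]
  have h2 : ∀ k : ℕ, (2 : ℝ≥0∞) * ((2 : ℝ≥0∞) ^ (k + 1))⁻¹ = (2 ^ k)⁻¹ := by
    intro k
    rw [pow_succ, ENNReal.mul_inv (by simp) (by simp), mul_comm, mul_assoc,
      ENNReal.inv_mul_cancel (by simp) (by simp), mul_one]
  have hsplit := tsum_eq_zero_add' (f := fun k : ℕ =>
    ((2 : ℝ≥0∞) ^ k)⁻¹ * s.indicator (1 : ℝ → ℝ≥0∞) ((2 : ℝ) ^ k)) ENNReal.summable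
  simp only [pow_zero, inv_one, one_mul] at hsplit
  rw [← two_mul, ← ENNReal.tsum_mul_left, measure_univ, one_smul, Measure.dirac_apply' _ hs,
    ← hsplit]
  exact tsum_congr fun k => by rw [← mul_assoc, h2]

theorem stmt19 (ν γ : Measure ℝ) [IsProbabilityMeasure ν] [IsProbabilityMeasure γ]
    (hν : ∀ k : ℕ, ν {(2 : ℝ) ^ k} = ((2 : ℝ≥0∞) ^ (k + 1))⁻¹)
    (hγ : ∀ k : ℕ, γ {-(2 : ℝ) ^ (k + 1)} = ((2 : ℝ≥0∞) ^ (k + 1))⁻¹) :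
    {c : ℝ | IsCompletelyMixable 3 ((3 : ℝ≥0∞)⁻¹ • ((2 : ℝ≥0∞) • ν + γ)) c} =
      {0, 1 / 3} := by
  have hν' := eq_halfGeometric_map two_pow_injective hν
  have hγ' := eq_halfGeometric_map neg_two_pow_succ_injective hγ
  have hν0 := measure_compl_range_eq_zero two_pow_injective hν
  have hγ0 := measure_compl_range_eq_zero neg_two_pow_succ_injective hγ
  ext c
  simp only [Set.mem_ofPred_eq, Set.mem_insert_iff, Set.mem_singleton_iff]
  constructor
  · intro hc
    set μ : Measure ℝ := (3 : ℝ≥0∞)⁻¹ • ((2 : ℝ≥0∞) • ν + γ) with hμdef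
    have : IsProbabilityMeasure μ := ⟨by
      simp only [hμdef, Measure.smul_apply, Measure.add_apply, measure_univ, smul_eq_mul, mul_one]
      rw [show (2 + 1 : ℝ≥0∞) = 3 by norm_num]
      exact ENNReal.inv_mul_cancel (by simp) (by simp)⟩
    have hreal : ∀ x : ℝ, μ.real {x} = (2 * ν.real {x} + γ.real {x}) / 3 := by
      intro x
      have h2 : (2 : ℝ≥0∞) * ν {x} ≠ ∞ := ENNReal.mul_ne_top (by simp) (measure_ne_top _ _)
      simp only [hμdef, Measure.real, Measure.smul_apply, Measure.add_apply, smul_eq_mul,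
        ENNReal.toReal_mul, ENNReal.toReal_add h2 (measure_ne_top _ _)]
      simp
      ring
    have hνr : ∀ k : ℕ, ν.real {(2 : ℝ) ^ k} = (2 ^ (k + 1))⁻¹ := by
      intro k; simp [Measure.real, hν]
    have hγr : ∀ k : ℕ, γ.real {-(2 : ℝ) ^ (k + 1)} = (2 ^ (k + 1))⁻¹ := by
      intro k; simp [Measure.real, hγ]
    have hν_neg : ∀ x : ℝ, x ≤ 0 → ν.real {x} = 0 := by
      intro x hx
      have : ν {x} = 0 := by
        refine measure_mono_null ?_ hν0
        rintro _ rfl ⟨k, rfl⟩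
        exact absurd hx (not_le.2 (by positivity))
      simp [Measure.real, this]
    have hγ_pos : ∀ x : ℝ, 0 ≤ x → γ.real {x} = 0 := by
      intro x hx
      have : γ {x} = 0 := by
        refine measure_mono_null ?_ hγ0
        rintro _ rfl ⟨k, rfl⟩
        exact absurd hx (not_le.2 (neg_lt_zero.2 (by positivity)))
      simp [Measure.real, this]
    have hpow : ∀ k : ℕ, μ.real {(2 : ℝ) ^ k} = (2 ^ k)⁻¹ / 3 := by
      intro k
      rw [hreal, hνr, hγ_pos _ (by positivity), pow_succ]
      field_simp
      ring
    have hneg : ∀ k : ℕ, μ.real {-(2 : ℝ) ^ (k + 1)} = (2 ^ (k + 1))⁻¹ / 3 := by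
      intro k
      rw [hreal, hγr, hν_neg _ (neg_nonpos.2 (by positivity))]
      ring
    have hsupp : ∀ᵐ (x : ℝ) ∂μ, ∃ n : ℤ, x = n ∧ IsOneOrSignedTwoPow n := by
      have h1 : ∀ᵐ (x : ℝ) ∂ν, ∃ n : ℤ, x = n ∧ IsOneOrSignedTwoPow n := by
        filter_upwards [(mem_ae_iff.2 hν0 : Set.range _ ∈ ae ν)]
        rintro _ ⟨_ | k, rfl⟩
        · exact ⟨1, by simp, Or.inl rfl⟩
        · exact ⟨2 ^ (k + 1), by simp, Or.inr ⟨k, Or.inl rfl⟩⟩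
      have h2 : ∀ᵐ (x : ℝ) ∂γ, ∃ n : ℤ, x = n ∧ IsOneOrSignedTwoPow n := by
        filter_upwards [(mem_ae_iff.2 hγ0 : Set.range _ ∈ ae γ)]
        rintro _ ⟨k, rfl⟩
        exact ⟨-2 ^ (k + 1), by simp, Or.inr ⟨k, Or.inr rfl⟩⟩
      exact Measure.ae_smul_measure (ae_add_measure_iff.2 ⟨Measure.ae_smul_measure h1 _, h2⟩) _
    have hone : μ.real {(1 : ℝ)} = 1 / 3 := by simpa using hpow 0
    obtain ⟨C, hC⟩ := exists_int_eq_three_mul_center hc hsupp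
    rcases Int.emod_two_eq_zero_or_one C with hpar | hpar
    · left
      have h := measureReal_one_le_of_even hc hsupp hC hpar
      have hT : IsOneOrSignedTwoPow (C - 2) := by
        by_contra hT
        have h0 : μ {((C - 2 : ℤ) : ℝ)} = 0 := by
          refine measure_mono_null ?_ hsupp
          rintro _ rfl ⟨n, hn, hn'⟩
          exact hT (by rwa [Int.cast_inj.1 hn])
        rw [hone, Measure.real, h0] at h
        norm_num at h
      have hsmall : ∀ k : ℕ, (1 : ℝ) / 3 ≤ 2 * ((2 ^ (k + 1))⁻¹ / 3) → k = 0 := by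
        intro k hk
        by_contra hk0
        have h4 : (4 : ℝ) ≤ 2 ^ (k + 1) := by
          calc (4 : ℝ) = 2 ^ 2 := by norm_num
            _ ≤ 2 ^ (k + 1) := pow_le_pow_right₀ (by norm_num) (by omega)
        have := inv_anti₀ (by norm_num) h4
        linarith
      rcases hT with hT | ⟨k, hT | hT⟩
      · omega
      · rw [hT, hone] at h
        push_cast at h
        rw [hpow] at h
        have hk := hsmall k h
        subst hk
        have hC4 : C = 4 := by norm_num at hT; omega
        subst hC4
        have h4 := measureReal_le_of_eq_four hc hsupp (by exact_mod_cast hC)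
        have e1 := hpow 1
        have e3 := hpow 3
        have e2 := hneg 0
        norm_num at e1 e2 e3
        rw [hone, e1, e2, e3] at h4
        norm_num at h4
      · rw [hT, hone] at h
        push_cast at h
        rw [hneg] at h
        have hk := hsmall k h
        subst hk
        have hC0 : C = 0 := by norm_num at hT; omega
        subst hC0
        simpa using hC.symm
    · right
      by_contra hne
      have hC1 : C ≠ 1 := by
        rintro rfl
        apply hne
        push_cast at hC
        linarith
      obtain ⟨K, hK⟩ := pow_unbounded_of_one_lt (2 * |C - 1|) (one_lt_two : (1 : ℤ) < 2)
      have h := measureReal_two_pow_le_of_odd hc hsupp hC hpar hC1 hK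
      rw [hone, hpow] at h
      have : (0 : ℝ) < (2 ^ K)⁻¹ / 3 := by positivity
      linarith
  · rw [two_smul, hν', hγ']
    rintro (rfl | rfl)
    · exact isCompletelyMixable_average _ _ _ _ fun k => by ring
    · rw [halfGeometric_map_two_pow_add_self]
      exact isCompletelyMixable_average _ _ _ _ fun k => by ring
end
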